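/- arXiv:1312.3909 — 2 statements merged into one kernel-verified Lean document; each statement's English description precedes it below -/
import Mathlib

section
/- (Lipschitz bound for the energy function on a tree) Let Γ be a connected metric tree and V ⊂ V(Γ) a nonempty set of Dirichlet vertices. Let w ∈ H¹₀(Γ;V) be the energy function on Γ with Dirichlet conditions in V, i.e. the unique minimizer of J over H¹₀(Γ;V). Then ‖w'‖_{L^∞} ≤ l(Γ), i.e. for every edge e_{ij} one has |w'_{ij}(x)| ≤ l(Γ) for a.e. x ∈ [0,l_{ij}]. -/
open MeasureTheory Set Filter
open scoped ENNReal

/-- A metric graph: a finite combinatorial graph on `N` vertices (an irreflexive symmetric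
edge relation) together with a positive length assigned to each edge. -/
structure MetricGraph where
  N : ℕ
  edge : Fin N → Fin N → Prop
  edge_symm : ∀ i j, edge i j → edge j i
  edge_irrefl : ∀ i, ¬ edge i i
  len : Fin N → Fin N → ℝ
  len_symm : ∀ i j, len i j = len j i
  len_pos : ∀ i j, edge i j → 0 < len i j

namespace MetricGraph

open scoped Classical in
/-- Total length of a metric graph: the sum of the lengths of its edges. -/
noncomputable def totalLength (G : MetricGraph) : ℝ :=
  ∑ i : Fin G.N, ∑ j : Fin G.N, if i < j ∧ G.edge i j then G.len i j else 0

open scoped Classical in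
/-- The number of (undirected) edges. -/
noncomputable def edgeCount (G : MetricGraph) : ℕ :=
  ∑ i : Fin G.N, ∑ j : Fin G.N, if i < j ∧ G.edge i j then 1 else 0

open scoped Classical in
/-- The degree of a vertex: the number of edges incident to it. -/
noncomputable def degree (G : MetricGraph) (i : Fin G.N) : ℕ :=
  ∑ j : Fin G.N, if G.edge i j then 1 else 0

/-- A metric graph is connected if it is nonempty and any two vertices are joined by a path. -/
def Connected (G : MetricGraph) : Prop :=
  0 < G.N ∧ ∀ i j : Fin G.N, Relation.ReflTransGen G.edge i j

/-- The graph obtained by removing the (undirected) edge `{a, b}`. -/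
def removeEdge (G : MetricGraph) (a b : Fin G.N) : MetricGraph where
  N := G.N
  edge i j := G.edge i j ∧ ¬((i = a ∧ j = b) ∨ (i = b ∧ j = a))
  edge_symm := fun i j h => ⟨G.edge_symm i j h.1, by tauto⟩
  edge_irrefl := fun i h => G.edge_irrefl i h.1
  len := G.len
  len_symm := G.len_symm
  len_pos := fun i j h => G.len_pos i j h.1

/-- A tree is a connected graph which becomes disconnected after the removal of any edge. -/
def IsTree (G : MetricGraph) : Prop :=
  G.Connected ∧ ∀ a b, G.edge a b → ¬ (G.removeEdge a b).Connected

end MetricGraph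

/-- A function in `H¹(Γ)` on a metric graph `Γ`: a family of `H¹` functions on the edges
(recorded together with their derivatives, via the fundamental theorem of calculus),
compatible with the orientation reversal `u ji x = u ij (l ij - x)` and continuous at
the vertices. -/
structure H1Fun (G : MetricGraph) where
  toFun : Fin G.N → Fin G.N → ℝ → ℝ
  deriv : Fin G.N → Fin G.N → ℝ → ℝ
  symm : ∀ i j, G.edge i j → ∀ x, toFun j i x = toFun i j (G.len i j - x)
  vertexCont : ∀ i j k, G.edge i j → G.edge i k → toFun i j 0 = toFun i k 0
  deriv_integrable : ∀ i j, G.edge i j →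
    MeasureTheory.IntegrableOn (deriv i j) (Set.Icc 0 (G.len i j))
  deriv_sq_integrable : ∀ i j, G.edge i j →
    MeasureTheory.IntegrableOn (fun t => (deriv i j t) ^ 2) (Set.Icc 0 (G.len i j))
  ftc : ∀ i j, G.edge i j → ∀ x ∈ Set.Icc (0 : ℝ) (G.len i j),
    toFun i j x = toFun i j 0 + ∫ t in (0 : ℝ)..x, deriv i j t

/-- `u` vanishes at every vertex of `W` (Dirichlet condition). -/
def H1Fun.ZeroOn {G : MetricGraph} (u : H1Fun G) (W : Set (Fin G.N)) : Prop :=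
  ∀ i ∈ W, ∀ j, G.edge i j → u.toFun i j 0 = 0

open scoped Classical in
/-- The functional `J(u) = ½∫_Γ |u'|² dx - ∫_Γ u dx`. -/
noncomputable def energyJ (G : MetricGraph) (u : H1Fun G) : ℝ :=
  ∑ i : Fin G.N, ∑ j : Fin G.N,
    if i < j ∧ G.edge i j then
      (1 / 2) * (∫ x in (0 : ℝ)..(G.len i j), (u.deriv i j x) ^ 2)
        - ∫ x in (0 : ℝ)..(G.len i j), u.toFun i j x
    else 0

/-- The Dirichlet energy `E(Γ; W)`. -/
noncomputable def dirEnergy (G : MetricGraph) (W : Set (Fin G.N)) : ℝ :=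
  sInf {e : ℝ | ∃ u : H1Fun G, u.ZeroOn W ∧ energyJ G u = e}

/-- An immersion of a metric graph into `ℝ^d`: a continuous map whose restriction to every
edge is an injective arc-length parametrized curve. -/
structure Immersion (G : MetricGraph) (d : ℕ) where
  toFun : Fin G.N → Fin G.N → ℝ → EuclideanSpace ℝ (Fin d)
  vpos : Fin G.N → EuclideanSpace ℝ (Fin d)
  start : ∀ i j, G.edge i j → toFun i j 0 = vpos i
  symm : ∀ i j, G.edge i j → ∀ x, toFun j i x = toFun i j (G.len i j - x)
  arclen : ∀ i j, G.edge i j → ∀ s t : ℝ, 0 ≤ s → s ≤ t → t ≤ G.len i j →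
    eVariationOn (toFun i j) (Set.Icc s t) = ENNReal.ofReal (t - s)
  inj : ∀ i j, G.edge i j → Set.InjOn (toFun i j) (Set.Icc 0 (G.len i j))

/-- An embedding is an injective immersion: the interiors of distinct edges are pairwise
disjoint and disjoint from all edges, and distinct vertices have distinct images. -/
def Immersion.IsEmbedding {G : MetricGraph} {d : ℕ} (γ : Immersion G d) : Prop :=
  (∀ i j i' j', G.edge i j → G.edge i' j' → ¬((i = i' ∧ j = j') ∨ (i = j' ∧ j = i')) →
    ∀ x ∈ Set.Ioo (0 : ℝ) (G.len i j), ∀ y ∈ Set.Icc (0 : ℝ) (G.len i' j'),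
      γ.toFun i j x ≠ γ.toFun i' j' y) ∧
  Function.Injective γ.vpos

/-- The Steiner length of a set `D ⊆ ℝ^d`: the infimum of the `H¹` lengths of the closed
connected sets containing `D`. -/
noncomputable def SteinerLen {d : ℕ} (D : Set (EuclideanSpace ℝ (Fin d))) : ℝ :=
  sInf {l : ℝ | 0 ≤ l ∧ ∃ C : Set (EuclideanSpace ℝ (Fin d)),
    IsClosed C ∧ IsConnected C ∧ D ⊆ C ∧ μH[1] C = ENNReal.ofReal l}

section OneDimensional

variable {f f' g : ℝ → ℝ} {l : ℝ}

theorem lipschitzWith_one_integral_of_mem_Icc (hg : Continuous g)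
    (hg01 : ∀ x, g x ∈ Icc (0 : ℝ) 1) :
    LipschitzWith 1 (fun s => ∫ y in (0 : ℝ)..s, g y) := by
  refine LipschitzWith.of_dist_le_mul fun x y => ?_
  rw [Real.dist_eq, Real.dist_eq, NNReal.coe_one, intervalIntegral.integral_interval_sub_left
    (hg.intervalIntegrable _ _) (hg.intervalIntegrable _ _), ← Real.norm_eq_abs]
  refine intervalIntegral.norm_integral_le_of_norm_le_const fun t _ => ?_
  rw [Real.norm_eq_abs, abs_of_nonneg (hg01 t).1]
  exact (hg01 t).2

theorem LipschitzWith.comp_absolutelyContinuousOnInterval {ψ : ℝ → ℝ} {K : NNReal} {a b : ℝ}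
    (hψ : LipschitzWith K ψ) (hf : AbsolutelyContinuousOnInterval f a b) :
    AbsolutelyContinuousOnInterval (fun x => ψ (f x)) a b := by
  refine squeeze_zero (fun t => Finset.sum_nonneg fun i _ => dist_nonneg) (fun t => ?_)
    (by simpa using Tendsto.const_mul (K : ℝ) hf)
  rw [Finset.mul_sum]
  gcongr
  exact hψ.dist_le_mul _ _

theorem absolutelyContinuousOnInterval_of_eq_add_integral (hl : 0 ≤ l)
    (hf' : IntegrableOn f' (Icc 0 l))
    (hf : ∀ x ∈ Icc 0 l, f x = f 0 + ∫ t in (0 : ℝ)..x, f' t) :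
    AbsolutelyContinuousOnInterval f 0 l := by
  have hi : IntervalIntegrable f' volume 0 l :=
    (intervalIntegrable_iff_integrableOn_Icc_of_le hl).2 hf'
  have h1 : LipschitzOnWith 0 (fun _ : ℝ => f 0) (uIcc 0 l) :=
    (LipschitzWith.const (f 0)).lipschitzOnWith
  have h := h1.absolutelyContinuousOnInterval.add
    (hi.absolutelyContinuousOnInterval_intervalIntegral left_mem_uIcc)
  rw [absolutelyContinuousOnInterval_iff] at h ⊢
  intro ε hε
  obtain ⟨δ, hδ, H⟩ := h ε hε
  refine ⟨δ, hδ, fun E hE hlt => ?_⟩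
  refine lt_of_le_of_lt (le_of_eq (Finset.sum_congr rfl fun i hi => ?_)) (H E hE hlt)
  have hm := hE.1 i hi
  rw [uIcc_of_le hl] at hm
  rw [hf _ hm.1, hf _ hm.2]
  rfl

theorem ae_hasDerivAt_of_eq_add_integral (hf' : IntegrableOn f' (Icc 0 l))
    (hf : ∀ x ∈ Icc 0 l, f x = f 0 + ∫ t in (0 : ℝ)..x, f' t) :
    ∀ᵐ x, x ∈ Ioo 0 l → HasDerivAt f (f' x) x := by
  by_cases hl : 0 ≤ l
  swap
  · simp [Ioo_eq_empty (fun h : 0 < l => hl h.le)]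
  have hi : IntervalIntegrable f' volume 0 l :=
    (intervalIntegrable_iff_integrableOn_Icc_of_le hl).2 hf'
  filter_upwards [hi.ae_hasDerivAt_integral] with x hx hxl
  have h := (hx (by rw [uIcc_of_le hl]; exact Ioo_subset_Icc_self hxl) 0 left_mem_uIcc).const_add
    (f 0)
  refine h.congr_of_eventuallyEq ?_
  filter_upwards [Ioo_mem_nhds hxl.1 hxl.2] with y hy
  exact hf y (Ioo_subset_Icc_self hy)

theorem comp_eq_add_integral_of_eq_add_integral (hg : Continuous g)
    (hg01 : ∀ x, g x ∈ Icc (0 : ℝ) 1) (hf' : IntegrableOn f' (Icc 0 l))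
    (hf : ∀ x ∈ Icc 0 l, f x = f 0 + ∫ t in (0 : ℝ)..x, f' t) {x : ℝ} (hx : x ∈ Icc 0 l) :
    ∫ y in (0 : ℝ)..f x, g y = (∫ y in (0 : ℝ)..f 0, g y) + ∫ t in (0 : ℝ)..x, g (f t) * f' t := by
  have hsub : Icc 0 x ⊆ Icc 0 l := Icc_subset_Icc_right hx.2
  have hac := (lipschitzWith_one_integral_of_mem_Icc hg hg01).comp_absolutelyContinuousOnInterval
    (absolutelyContinuousOnInterval_of_eq_add_integral hx.1 (hf'.mono_set hsub)
      fun y hy => hf y (hsub hy))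
  rw [← sub_eq_iff_eq_add', ← hac.integral_deriv_eq_sub]
  refine intervalIntegral.integral_congr_ae ?_
  have hne : ∀ᵐ t : ℝ, t ≠ x := by simp [ae_iff, measure_singleton]
  filter_upwards [ae_hasDerivAt_of_eq_add_integral hf' hf, hne] with t ht htx htm
  rw [uIoc_of_le hx.1] at htm
  have hd := ht ⟨htm.1, (lt_of_le_of_ne htm.2 htx).trans_le hx.2⟩
  exact ((intervalIntegral.integral_hasDerivAt_right (hg.intervalIntegrable _ _)
    (hg.stronglyMeasurableAtFilter _ _) hg.continuousAt).comp t hd).deriv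

theorem sq_integral_le_mul_integral_sq {a b : ℝ} (hab : a ≤ b)
    (hf' : IntervalIntegrable f' volume a b)
    (hf'2 : IntervalIntegrable (fun t => f' t ^ 2) volume a b) :
    (∫ t in a..b, f' t) ^ 2 ≤ (b - a) * ∫ t in a..b, f' t ^ 2 := by
  have key : ∀ c : ℝ, 0 ≤ (b - a) * (c * c) + (-2 * ∫ t in a..b, f' t) * c
      + ∫ t in a..b, f' t ^ 2 := by
    intro c
    have h0 : 0 ≤ ∫ t in a..b, (f' t - c) ^ 2 :=
      intervalIntegral.integral_nonneg hab fun t _ => sq_nonneg _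
    have h1 : ∫ t in a..b, (f' t - c) ^ 2 =
        ∫ t in a..b, (f' t ^ 2 - (2 * c) * f' t + c * c) := by
      congr 1; ext t; ring
    rw [h1, intervalIntegral.integral_add (hf'2.sub (hf'.const_mul _))
      intervalIntegrable_const, intervalIntegral.integral_sub hf'2 (hf'.const_mul _),
      intervalIntegral.integral_const_mul, intervalIntegral.integral_const, smul_eq_mul] at h0
    linarith
  have := discrim_le_zero key
  unfold discrim at this
  linarith

/-- A function whose Dirichlet energy between two levels is at most `L` times the distance of
the levels is `L`-Lipschitz. -/
theorem abs_sub_le_of_integral_comp_mul_sq_le {L : ℝ} (hL : 0 ≤ L)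
    (hf' : IntegrableOn f' (Icc 0 l)) (hf'2 : IntegrableOn (fun t => f' t ^ 2) (Icc 0 l))
    (hf : ∀ x ∈ Icc 0 l, f x = f 0 + ∫ t in (0 : ℝ)..x, f' t)
    (H : ∀ g : ℝ → ℝ, Continuous g → (∀ x, g x ∈ Icc (0 : ℝ) 1) → ∀ c d : ℝ, c ≤ d →
      (∀ x, x ∉ Icc c d → g x = 0) →
      ∫ t in (0 : ℝ)..l, g (f t) * f' t ^ 2 ≤ L * (d - c))
    {p q : ℝ} (hp : p ∈ Icc 0 l) (hq : q ∈ Icc 0 l) (hpq : p ≤ q) :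
    |f q - f p| ≤ L * (q - p) := by
  have hl : 0 ≤ l := hp.1.trans hp.2
  have hcont : ContinuousOn f (Icc 0 l) := by
    have := (absolutelyContinuousOnInterval_of_eq_add_integral hl hf' hf).continuousOn
    rwa [uIcc_of_le hl] at this
  have hsub : Icc p q ⊆ Icc 0 l := Icc_subset_Icc hp.1 hq.2
  obtain ⟨m, hm, hmin⟩ := isCompact_Icc.exists_isMinOn (nonempty_Icc.2 hpq) (hcont.mono hsub)
  obtain ⟨M, hM, hmax⟩ := isCompact_Icc.exists_isMaxOn (nonempty_Icc.2 hpq) (hcont.mono hsub)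
  have hmin' : ∀ x ∈ Icc p q, f m ≤ f x := fun x hx => hmin hx
  have hmax' : ∀ x ∈ Icc p q, f x ≤ f M := fun x hx => hmax hx
  have hD : 0 ≤ f M - f m := sub_nonneg.2 (hmin' M hM)
  have hii : ∀ {h : ℝ → ℝ} {a b : ℝ}, IntegrableOn h (Icc 0 l) → a ∈ Icc p q → b ∈ Icc p q →
      IntervalIntegrable h volume a b := fun hh ha hb =>
    (hh.mono_set ((ordConnected_Icc.uIcc_subset ha hb).trans hsub)).intervalIntegrable
  have hsq : (f M - f m) ^ 2 ≤ (q - p) * ∫ t in p..q, f' t ^ 2 := by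
    have hnn : ∀ a b : ℝ, a ≤ b → 0 ≤ ∫ t in a..b, f' t ^ 2 := fun a b hab =>
      intervalIntegral.integral_nonneg hab fun _ _ => sq_nonneg _
    have main : ∀ a ∈ Icc p q, ∀ b ∈ Icc p q, a ≤ b →
        (f b - f a) ^ 2 ≤ (q - p) * ∫ t in p..q, f' t ^ 2 := by
      intro a ha b hb hab
      have e : f b - f a = ∫ t in a..b, f' t := by
        have h0 : ∀ x ∈ Icc p q, IntervalIntegrable f' volume 0 x := fun x hx =>
          (intervalIntegrable_iff_integrableOn_Icc_of_le (hsub hx).1).2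
            (hf'.mono_set (Icc_subset_Icc_right (hsub hx).2))
        rw [hf b (hsub hb), hf a (hsub ha), add_sub_add_left_eq_sub,
          intervalIntegral.integral_interval_sub_left (h0 b hb) (h0 a ha)]
      rw [e]
      refine (sq_integral_le_mul_integral_sq hab (hii hf' ha hb) (hii hf'2 ha hb)).trans ?_
      refine mul_le_mul (by linarith [ha.1, hb.2]) ?_ (hnn a b hab) (sub_nonneg.2 hpq)
      exact intervalIntegral.integral_mono_interval ha.1 hab hb.2
        (Eventually.of_forall fun _ => sq_nonneg _)
        (hii hf'2 (left_mem_Icc.2 hpq) (right_mem_Icc.2 hpq))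
    rcases le_total m M with h | h
    · exact main m hm M hM h
    · rw [← neg_sub, neg_sq]; exact main M hM m hm h
  have hen : ∀ η > 0, ∫ t in p..q, f' t ^ 2 ≤ L * (f M - f m + 2 * η) := by
    intro η hη
    obtain ⟨g, hg0, hg1, hg01⟩ := exists_continuous_zero_one_of_isClosed
      (s := (Ioo (f m - η) (f M + η))ᶜ) (t := Icc (f m) (f M)) isOpen_Ioo.isClosed_compl
      isClosed_Icc (disjoint_compl_left_iff_subset.2
        fun x hx => ⟨by linarith [hx.1], by linarith [hx.2]⟩)
    have h1 := H g g.continuous hg01 (f m - η) (f M + η) (by linarith)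
      fun x hx => hg0 fun hx' => hx (Ioo_subset_Icc_self hx')
    have hgi : IntegrableOn (fun t => g (f t) * f' t ^ 2) (Icc 0 l) :=
      hf'2.continuousOn_mul (g.continuous.comp_continuousOn hcont) isCompact_Icc
    have h2 : ∫ t in p..q, f' t ^ 2 = ∫ t in p..q, g (f t) * f' t ^ 2 := by
      refine intervalIntegral.integral_congr fun t ht => ?_
      rw [uIcc_of_le hpq] at ht
      have : g (f t) = 1 := hg1 ⟨hmin' t ht, hmax' t ht⟩
      simp [this]
    rw [h2]
    refine (intervalIntegral.integral_mono_interval hp.1 hpq hq.2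
      (Eventually.of_forall fun t => mul_nonneg (hg01 _).1 (sq_nonneg _))
      ((intervalIntegrable_iff_integrableOn_Icc_of_le hl).2 hgi)).trans (h1.trans_eq ?_)
    ring
  have hen0 : ∫ t in p..q, f' t ^ 2 ≤ L * (f M - f m) := by
    refine le_of_forall_pos_le_add fun ε hε => ?_
    refine (hen (ε / (2 * (L + 1))) (by positivity)).trans ?_
    have : L * (2 * (ε / (2 * (L + 1)))) ≤ ε := by
      have : L * (2 * (ε / (2 * (L + 1)))) = ε * (L / (L + 1)) := by field_simp
      rw [this]
      exact mul_le_of_le_one_right hε.le ((div_le_one (by linarith)).2 (by linarith))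
    linarith
  have hfin : f M - f m ≤ L * (q - p) := by
    rcases hD.eq_or_lt with h | h
    · rw [← h]; exact mul_nonneg hL (sub_nonneg.2 hpq)
    · have := hsq.trans (mul_le_mul_of_nonneg_left hen0 (sub_nonneg.2 hpq))
      nlinarith
  have hpm := left_mem_Icc.2 hpq
  have hqm := right_mem_Icc.2 hpq
  rw [abs_le]
  constructor <;> linarith [hmin' p hpm, hmin' q hqm, hmax' p hpm, hmax' q hqm]

theorem ae_abs_le_of_lipschitz {L : ℝ} (hL : 0 ≤ L) (hf' : IntegrableOn f' (Icc 0 l))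
    (hf : ∀ x ∈ Icc 0 l, f x = f 0 + ∫ t in (0 : ℝ)..x, f' t)
    (H : ∀ p ∈ Icc 0 l, ∀ q ∈ Icc 0 l, p ≤ q → |f q - f p| ≤ L * (q - p)) :
    ∀ᵐ x ∂(volume.restrict (Icc 0 l)), |f' x| ≤ L := by
  rw [← restrict_Ioo_eq_restrict_Icc, ae_restrict_iff' measurableSet_Ioo]
  filter_upwards [ae_hasDerivAt_of_eq_add_integral hf' hf] with x hx hxl
  refine (hx hxl).le_of_lip' hL ?_
  filter_upwards [Ioo_mem_nhds hxl.1 hxl.2] with y hy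
  have hx' := Ioo_subset_Icc_self hxl
  have hy' := Ioo_subset_Icc_self hy
  rw [Real.norm_eq_abs, Real.norm_eq_abs]
  rcases le_total x y with h | h
  · rw [abs_of_nonneg (sub_nonneg.2 h)]; exact H x hx' y hy' h
  · rw [abs_sub_comm, abs_of_nonpos (sub_nonpos.2 h), neg_sub]; exact H y hy' x hx' h

theorem abs_integral_le_of_support_subset_Icc (hg01 : ∀ x, g x ∈ Icc (0 : ℝ) 1) {c d : ℝ}
    (hcd : c ≤ d) (hsupp : ∀ x, x ∉ Icc c d → g x = 0) (s : ℝ) :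
    |∫ y in (0 : ℝ)..s, g y| ≤ d - c := by
  rw [intervalIntegral.abs_integral_eq_abs_integral_uIoc, ← Real.norm_eq_abs]
  refine (norm_integral_le_integral_norm _).trans ?_
  have hle : ∀ x, ‖g x‖ ≤ (Icc c d).indicator (fun _ => (1 : ℝ)) x := by
    intro x
    by_cases hx : x ∈ Icc c d
    · rw [indicator_of_mem hx, Real.norm_eq_abs, abs_of_nonneg (hg01 x).1]; exact (hg01 x).2
    · simp [hx, hsupp x hx]
  have hint : Integrable ((Icc c d).indicator (fun _ => (1 : ℝ))) :=
    (integrable_indicator_iff measurableSet_Icc).2 (integrableOn_const (by simp))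
  calc ∫ x in uIoc 0 s, ‖g x‖
      ≤ ∫ x in uIoc 0 s, (Icc c d).indicator (fun _ => (1 : ℝ)) x :=
        integral_mono_of_nonneg (Eventually.of_forall fun _ => norm_nonneg _)
          hint.integrableOn (Eventually.of_forall hle)
    _ ≤ ∫ x, (Icc c d).indicator (fun _ => (1 : ℝ)) x :=
        setIntegral_le_integral hint
          (Eventually.of_forall fun x => indicator_nonneg (fun _ _ => zero_le_one) x)
    _ = d - c := by
        rw [integral_indicator measurableSet_Icc]
        simp [hcd]

end OneDimensional

namespace H1Fun

variable {G : MetricGraph} (w : H1Fun G) {g : ℝ → ℝ}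

theorem continuousOn {i j : Fin G.N} (h : G.edge i j) :
    ContinuousOn (w.toFun i j) (Icc 0 (G.len i j)) := by
  have hl := (G.len_pos i j h).le
  have := (absolutelyContinuousOnInterval_of_eq_add_integral hl (w.deriv_integrable i j h)
    (w.ftc i j h)).continuousOn
  rwa [uIcc_of_le hl] at this

theorem continuousOn_comp (hg : Continuous g) {i j : Fin G.N} (h : G.edge i j) :
    ContinuousOn (fun x => g (w.toFun i j x)) (Icc 0 (G.len i j)) :=
  hg.comp_continuousOn (w.continuousOn h)

/-- The function `w - s • ψ ∘ w`, where `ψ` is the primitive of `g` vanishing at `0`. -/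
noncomputable def subCompPrimitive (hg : Continuous g) (hg01 : ∀ x, g x ∈ Icc (0 : ℝ) 1) (s : ℝ) :
    H1Fun G where
  toFun i j x := w.toFun i j x - s * ∫ y in (0 : ℝ)..w.toFun i j x, g y
  deriv i j x := w.deriv i j x - s * (g (w.toFun i j x) * w.deriv i j x)
  symm i j h x := by rw [w.symm i j h x]
  vertexCont i j k hj hk := by rw [w.vertexCont i j k hj hk]
  deriv_integrable i j h := (w.deriv_integrable i j h).sub
    (((w.deriv_integrable i j h).continuousOn_mul (w.continuousOn_comp hg h)
      isCompact_Icc).const_mul s)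
  deriv_sq_integrable i j h := by
    have hc : ContinuousOn (fun x => (1 - s * g (w.toFun i j x)) ^ 2) (Icc 0 (G.len i j)) :=
      (continuousOn_const.sub (continuousOn_const.mul (w.continuousOn_comp hg h))).pow 2
    refine ((w.deriv_sq_integrable i j h).continuousOn_mul hc isCompact_Icc).congr
      (Eventually.of_forall fun x => ?_)
    simp only
    ring
  ftc i j h x hx := by
    have hii : ∀ {k : ℝ → ℝ}, IntegrableOn k (Icc 0 (G.len i j)) →
        IntervalIntegrable k volume 0 x := fun hk =>
      (intervalIntegrable_iff_integrableOn_Icc_of_le hx.1).2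
        (hk.mono_set (Icc_subset_Icc_right hx.2))
    have hgi := (w.deriv_integrable i j h).continuousOn_mul (w.continuousOn_comp hg h)
      isCompact_Icc
    rw [intervalIntegral.integral_sub (hii (w.deriv_integrable i j h)) ((hii hgi).const_mul s),
      intervalIntegral.integral_const_mul,
      comp_eq_add_integral_of_eq_add_integral hg hg01 (w.deriv_integrable i j h) (w.ftc i j h) hx]
    linarith [w.ftc i j h x hx]

theorem ZeroOn.subCompPrimitive {W : Set (Fin G.N)} {w : H1Fun G} (hw : w.ZeroOn W)
    (hg : Continuous g) (hg01 : ∀ x, g x ∈ Icc (0 : ℝ) 1) (s : ℝ) :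
    (w.subCompPrimitive hg hg01 s).ZeroOn W := by
  intro i hi j h
  simp [H1Fun.subCompPrimitive, hw i hi j h]

theorem edge_energy_subCompPrimitive (hg : Continuous g) (hg01 : ∀ x, g x ∈ Icc (0 : ℝ) 1) (s : ℝ)
    {i j : Fin G.N} (h : G.edge i j) :
    (1 / 2) * (∫ x in (0 : ℝ)..(G.len i j), ((w.subCompPrimitive hg hg01 s).deriv i j x) ^ 2)
        - ∫ x in (0 : ℝ)..(G.len i j), (w.subCompPrimitive hg hg01 s).toFun i j x =
      ((1 / 2) * (∫ x in (0 : ℝ)..(G.len i j), (w.deriv i j x) ^ 2)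
        - ∫ x in (0 : ℝ)..(G.len i j), w.toFun i j x)
      + s * ((∫ x in (0 : ℝ)..(G.len i j), ∫ y in (0 : ℝ)..w.toFun i j x, g y)
        - ∫ x in (0 : ℝ)..(G.len i j), g (w.toFun i j x) * w.deriv i j x ^ 2)
      + s * s * ((1 / 2) *
        ∫ x in (0 : ℝ)..(G.len i j), g (w.toFun i j x) ^ 2 * w.deriv i j x ^ 2) := by
  have hl := (G.len_pos i j h).le
  have hii : ∀ {k : ℝ → ℝ}, IntegrableOn k (Icc 0 (G.len i j)) →
      IntervalIntegrable k volume 0 (G.len i j) := fun hk =>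
    (intervalIntegrable_iff_integrableOn_Icc_of_le hl).2 hk
  have h2 := w.deriv_sq_integrable i j h
  have hK := hii (h2.continuousOn_mul (w.continuousOn_comp hg h) isCompact_Icc)
  have hQ := hii (h2.continuousOn_mul (w.continuousOn_comp (hg.pow 2) h) isCompact_Icc)
  simp only [Pi.pow_apply] at hQ
  have hw := hii ((w.continuousOn h).integrableOn_compact isCompact_Icc)
  have hψ := hii ((w.continuousOn_comp
    (lipschitzWith_one_integral_of_mem_Icc hg hg01).continuous h).integrableOn_compact
      isCompact_Icc)
  have e1 : (∫ x in (0 : ℝ)..(G.len i j), ((w.subCompPrimitive hg hg01 s).deriv i j x) ^ 2) =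
      ∫ x in (0 : ℝ)..(G.len i j), (w.deriv i j x ^ 2
        - (2 * s) * (g (w.toFun i j x) * w.deriv i j x ^ 2)
        + (s * s) * (g (w.toFun i j x) ^ 2 * w.deriv i j x ^ 2)) := by
    refine intervalIntegral.integral_congr fun x _ => ?_
    simp only [subCompPrimitive]
    ring
  have e2 : (∫ x in (0 : ℝ)..(G.len i j), (w.subCompPrimitive hg hg01 s).toFun i j x) =
      (∫ x in (0 : ℝ)..(G.len i j), w.toFun i j x)
        - s * ∫ x in (0 : ℝ)..(G.len i j), ∫ y in (0 : ℝ)..w.toFun i j x, g y := by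
    simp only [subCompPrimitive]
    rw [intervalIntegral.integral_sub hw (hψ.const_mul s), intervalIntegral.integral_const_mul]
  rw [e1, e2, intervalIntegral.integral_add ((hii h2).sub (hK.const_mul _)) (hQ.const_mul _),
    intervalIntegral.integral_sub (hii h2) (hK.const_mul _),
    intervalIntegral.integral_const_mul, intervalIntegral.integral_const_mul]
  ring

open scoped Classical in
/-- The Euler-Lagrange equation of a minimizer `w`, tested with a primitive of `g` composed
with `w`. -/
theorem sum_integral_comp_mul_sq_eq {V : Set (Fin G.N)} (hw0 : w.ZeroOn V)
    (hmin : ∀ u : H1Fun G, u.ZeroOn V → energyJ G w ≤ energyJ G u)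
    (hg : Continuous g) (hg01 : ∀ x, g x ∈ Icc (0 : ℝ) 1) :
    (∑ i : Fin G.N, ∑ j : Fin G.N, if i < j ∧ G.edge i j then
      ∫ x in (0 : ℝ)..(G.len i j), g (w.toFun i j x) * w.deriv i j x ^ 2 else 0) =
    ∑ i : Fin G.N, ∑ j : Fin G.N, if i < j ∧ G.edge i j then
      ∫ x in (0 : ℝ)..(G.len i j), ∫ y in (0 : ℝ)..w.toFun i j x, g y else 0 := by
  set K := ∑ i : Fin G.N, ∑ j : Fin G.N, if i < j ∧ G.edge i j then
      ∫ x in (0 : ℝ)..(G.len i j), g (w.toFun i j x) * w.deriv i j x ^ 2 else 0 with hKdef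
  set P := ∑ i : Fin G.N, ∑ j : Fin G.N, if i < j ∧ G.edge i j then
      ∫ x in (0 : ℝ)..(G.len i j), ∫ y in (0 : ℝ)..w.toFun i j x, g y else 0 with hPdef
  set Q := ∑ i : Fin G.N, ∑ j : Fin G.N, if i < j ∧ G.edge i j then
      (1 / 2) * ∫ x in (0 : ℝ)..(G.len i j), g (w.toFun i j x) ^ 2 * w.deriv i j x ^ 2
      else 0 with hQdef
  have hJ : ∀ s, energyJ G (w.subCompPrimitive hg hg01 s) =
      energyJ G w + s * (P - K) + s * s * Q := by
    intro s
    simp only [energyJ, hKdef, hPdef, hQdef, ← Finset.sum_sub_distrib, Finset.mul_sum,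
      ← Finset.sum_add_distrib]
    refine Finset.sum_congr rfl fun i _ => Finset.sum_congr rfl fun j _ => ?_
    split_ifs with h
    · exact w.edge_energy_subCompPrimitive hg hg01 s h.2
    · simp
  have hpos : ∀ s, 0 ≤ Q * (s * s) + (P - K) * s + 0 := by
    intro s
    have := hmin _ (hw0.subCompPrimitive hg hg01 s)
    rw [hJ s] at this
    linarith
  have h := discrim_le_zero hpos
  unfold discrim at h
  nlinarith

end H1Fun

theorem MetricGraph.totalLength_nonneg (G : MetricGraph) : 0 ≤ G.totalLength := by
  refine Finset.sum_nonneg fun i _ => Finset.sum_nonneg fun j _ => ?_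
  split_ifs with h
  · exact (G.len_pos i j h.2).le
  · exact le_rfl

theorem H1Fun.integral_comp_mul_sq_le {G : MetricGraph} {V : Set (Fin G.N)} {w : H1Fun G}
    (hw0 : w.ZeroOn V) (hmin : ∀ u : H1Fun G, u.ZeroOn V → energyJ G w ≤ energyJ G u)
    {i j : Fin G.N} (hij : i < j) (h : G.edge i j) {g : ℝ → ℝ} (hg : Continuous g)
    (hg01 : ∀ x, g x ∈ Icc (0 : ℝ) 1) {c d : ℝ} (hcd : c ≤ d)
    (hsupp : ∀ x, x ∉ Icc c d → g x = 0) :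
    ∫ x in (0 : ℝ)..(G.len i j), g (w.toFun i j x) * w.deriv i j x ^ 2
      ≤ G.totalLength * (d - c) := by
  classical
  set F : Fin G.N → Fin G.N → ℝ := fun i j => if i < j ∧ G.edge i j then
      ∫ x in (0 : ℝ)..(G.len i j), g (w.toFun i j x) * w.deriv i j x ^ 2 else 0 with hF
  have hF0 : ∀ i j, 0 ≤ F i j := by
    intro i j
    simp only [hF]
    split_ifs with h
    · exact intervalIntegral.integral_nonneg (G.len_pos i j h.2).le
        fun x _ => mul_nonneg (hg01 _).1 (sq_nonneg _)
    · exact le_rfl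
  have h1 : ∫ x in (0 : ℝ)..(G.len i j), g (w.toFun i j x) * w.deriv i j x ^ 2 = F i j := by
    simp [hF, hij, h]
  rw [h1]
  calc F i j ≤ ∑ j, F i j :=
        Finset.single_le_sum (f := F i) (fun j _ => hF0 i j) (Finset.mem_univ j)
    _ ≤ ∑ i, ∑ j, F i j := Finset.single_le_sum (f := fun i => ∑ j, F i j)
        (fun i _ => Finset.sum_nonneg fun j _ => hF0 i j) (Finset.mem_univ i)
    _ = _ := by
      convert w.sum_integral_comp_mul_sq_eq hw0 hmin hg hg01
    _ ≤ G.totalLength * (d - c) := by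
      rw [MetricGraph.totalLength, Finset.sum_mul]
      refine Finset.sum_le_sum fun i _ => ?_
      rw [Finset.sum_mul]
      refine Finset.sum_le_sum fun j _ => ?_
      split_ifs with h
      · have hl := (G.len_pos i j h.2).le
        have := intervalIntegral.norm_integral_le_of_norm_le_const (a := 0) (b := G.len i j)
          (f := fun x => ∫ y in (0 : ℝ)..w.toFun i j x, g y) (C := d - c)
          fun x _ => abs_integral_le_of_support_subset_Icc hg01 hcd hsupp _
        rw [sub_zero, abs_of_nonneg hl, mul_comm] at this
        exact (le_abs_self _).trans this
      · simp

theorem H1Fun.abs_sub_le_of_isMinimizer {G : MetricGraph} {V : Set (Fin G.N)} {w : H1Fun G}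
    (hw0 : w.ZeroOn V) (hmin : ∀ u : H1Fun G, u.ZeroOn V → energyJ G w ≤ energyJ G u)
    {i j : Fin G.N} (h : G.edge i j) {p q : ℝ} (hp : p ∈ Icc 0 (G.len i j))
    (hq : q ∈ Icc 0 (G.len i j)) (hpq : p ≤ q) :
    |w.toFun i j q - w.toFun i j p| ≤ G.totalLength * (q - p) := by
  have key : ∀ {i j : Fin G.N}, i < j → G.edge i j → ∀ p ∈ Icc 0 (G.len i j),
      ∀ q ∈ Icc 0 (G.len i j), p ≤ q →
      |w.toFun i j q - w.toFun i j p| ≤ G.totalLength * (q - p) :=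
    fun hij h p hp q hq hpq =>
      abs_sub_le_of_integral_comp_mul_sq_le G.totalLength_nonneg (w.deriv_integrable _ _ h)
        (w.deriv_sq_integrable _ _ h) (w.ftc _ _ h)
        (fun _ hg hg01 _ _ hcd hsupp => integral_comp_mul_sq_le hw0 hmin hij h hg hg01 hcd hsupp)
        hp hq hpq
  rcases lt_trichotomy i j with hij | rfl | hji
  · exact key hij h p hp q hq hpq
  · exact absurd h (G.edge_irrefl i)
  · have h' := G.edge_symm _ _ h
    rw [G.len_symm i j] at hp hq
    rw [w.symm j i h' q, w.symm j i h' p, abs_sub_comm]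
    convert key hji h' (G.len j i - q) ⟨by linarith [hq.2], by linarith [hq.1]⟩
      (G.len j i - p) ⟨by linarith [hp.2], by linarith [hp.1]⟩ (by linarith) using 2
    ring

/-- Lipschitz bound for the energy function on a connected metric tree:
if `w` minimizes `J` over `H¹₀(Γ; V)` (with `V` nonempty), then `‖w'‖_∞ ≤ l(Γ)`,
i.e. `|w'_{ij}(x)| ≤ l(Γ)` for a.e. `x ∈ [0, l_{ij}]` on every edge. -/
theorem energy_function_deriv_bound (G : MetricGraph) (hG : G.IsTree)
    (V : Set (Fin G.N)) (hV : V.Nonempty)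
    (w : H1Fun G) (hw0 : w.ZeroOn V)
    (hmin : ∀ u : H1Fun G, u.ZeroOn V → energyJ G w ≤ energyJ G u) :
    ∀ i j, G.edge i j →
      ∀ᵐ x ∂(MeasureTheory.volume.restrict (Set.Icc (0 : ℝ) (G.len i j))),
        |w.deriv i j x| ≤ G.totalLength := by
  intro i j h
  exact ae_abs_le_of_lipschitz G.totalLength_nonneg (w.deriv_integrable i j h) (w.ftc i j h)
    fun p hp q hq hpq => H1Fun.abs_sub_le_of_isMinimizer hw0 hmin h hp hq hpq
end

section
/- Let (Γ, V, γ) be a solution of the optimization problem (enim) for D = {D₁,…,D_k} and total length l, and let w be the energy function of Γ with Dirichlet conditions in V. If Γ contains a Neumann vertex V_j (a vertex of degree one not belonging to V), then w achieves its maximum over Γ at V_j. -/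
open MeasureTheory Set Filter
open scoped ENNReal

/-- `f` is an `H¹` function on `[0, L]` with weak derivative `g`. -/
structure IsH1On (f g : ℝ → ℝ) (L : ℝ) : Prop where
  integrable : IntegrableOn g (Icc 0 L)
  sq_integrable : IntegrableOn (fun t => g t ^ 2) (Icc 0 L)
  ftc : ∀ x ∈ Icc (0 : ℝ) L, f x = f 0 + ∫ t in (0 : ℝ)..x, g t

/-- The contribution `½∫₀ᴸ g² - ∫₀ᴸ f` of one edge to the functional `J`. -/
noncomputable def edgeJ (f g : ℝ → ℝ) (L : ℝ) : ℝ :=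
  (1 / 2) * (∫ x in (0 : ℝ)..L, (g x) ^ 2) - ∫ x in (0 : ℝ)..L, f x

theorem intervalIntegrable_of_integrableOn_Icc {g : ℝ → ℝ} {L x y : ℝ}
    (h : IntegrableOn g (Icc 0 L)) (hx : x ∈ Icc 0 L) (hy : y ∈ Icc 0 L) :
    IntervalIntegrable g volume x y :=
  (h.mono_set (ordConnected_Icc.uIcc_subset hx hy)).intervalIntegrable

theorem integrableOn_Icc_comp_sub_left {g : ℝ → ℝ} {L : ℝ} (hL : 0 ≤ L)
    (h : IntegrableOn g (Icc 0 L)) : IntegrableOn (fun x => g (L - x)) (Icc 0 L) := by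
  have h1 := ((intervalIntegrable_iff_integrableOn_Icc_of_le hL).2 h).comp_sub_left L
  rw [sub_zero, sub_self] at h1
  exact (intervalIntegrable_iff_integrableOn_Icc_of_le hL).1 h1.symm

theorem integrableOn_Icc_comp_add_left {g : ℝ → ℝ} {L a b : ℝ} (ha : 0 ≤ a) (hab : a ≤ b)
    (hb : b ≤ L) (h : IntegrableOn g (Icc 0 L)) :
    IntegrableOn (fun x => g (a + x)) (Icc 0 (b - a)) := by
  have h1 := (intervalIntegrable_of_integrableOn_Icc h (x := a) (y := b)
    ⟨ha, hab.trans hb⟩ ⟨ha.trans hab, hb⟩).comp_add_left a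
  rw [sub_self] at h1
  exact (intervalIntegrable_iff_integrableOn_Icc_of_le (sub_nonneg.2 hab)).1 h1

namespace IsH1On

variable {f g : ℝ → ℝ} {L : ℝ}

theorem sub_eq_integral (h : IsH1On f g L) {x y : ℝ} (hx : x ∈ Icc 0 L) (hy : y ∈ Icc 0 L) :
    f y - f x = ∫ t in x..y, g t := by
  have h0 : (0 : ℝ) ∈ Icc 0 L := ⟨le_rfl, hx.1.trans hx.2⟩
  rw [h.ftc x hx, h.ftc y hy, add_sub_add_left_eq_sub]
  exact intervalIntegral.integral_interval_sub_left
    (intervalIntegrable_of_integrableOn_Icc h.integrable h0 hy)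
    (intervalIntegrable_of_integrableOn_Icc h.integrable h0 hx)

theorem continuousOn (h : IsH1On f g L) (hL : 0 ≤ L) : ContinuousOn f (Icc 0 L) := by
  have h1 := intervalIntegral.continuousOn_primitive_interval (a := 0) (b := L) (f := g)
    (μ := volume) (by rw [uIcc_of_le hL]; exact h.integrable)
  rw [uIcc_of_le hL] at h1
  exact (continuousOn_const.add h1).congr h.ftc

theorem intervalIntegrable (h : IsH1On f g L) {x y : ℝ} (hx : x ∈ Icc 0 L) (hy : y ∈ Icc 0 L) :
    IntervalIntegrable f volume x y :=
  ((h.continuousOn (hx.1.trans hx.2)).mono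
    (ordConnected_Icc.uIcc_subset hx hy)).intervalIntegrable

theorem reverse (h : IsH1On f g L) (hL : 0 ≤ L) :
    IsH1On (fun x => f (L - x)) (fun x => -g (L - x)) L where
  integrable := (integrableOn_Icc_comp_sub_left hL h.integrable).neg
  sq_integrable := by
    simpa only [neg_sq] using integrableOn_Icc_comp_sub_left hL h.sq_integrable
  ftc x hx := by
    have h1 := h.sub_eq_integral (x := L - x) (y := L - 0) ⟨by linarith [hx.2], by linarith [hx.1]⟩
      ⟨by linarith, by linarith⟩
    rw [intervalIntegral.integral_neg, intervalIntegral.integral_comp_sub_left g L, ← h1]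
    ring

theorem comp_add_left (h : IsH1On f g L) {a b : ℝ} (ha : 0 ≤ a) (hab : a ≤ b) (hb : b ≤ L) :
    IsH1On (fun x => f (a + x)) (fun x => g (a + x)) (b - a) where
  integrable := integrableOn_Icc_comp_add_left ha hab hb h.integrable
  sq_integrable := integrableOn_Icc_comp_add_left ha hab hb h.sq_integrable
  ftc x hx := by
    have h1 := h.sub_eq_integral (x := a + 0) (y := a + x) ⟨by linarith, by linarith⟩
      ⟨by linarith [hx.1], by linarith [hx.2]⟩
    rw [intervalIntegral.integral_comp_add_left g a, ← h1]
    ring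

theorem mono (h : IsH1On f g L) {s : ℝ} (hs : s ≤ L) : IsH1On f g s where
  integrable := h.integrable.mono_set (Icc_subset_Icc_right hs)
  sq_integrable := h.sq_integrable.mono_set (Icc_subset_Icc_right hs)
  ftc x hx := h.ftc x ⟨hx.1, hx.2.trans hs⟩

theorem add_const (h : IsH1On f g L) (c : ℝ) : IsH1On (fun x => f x + c) g L where
  integrable := h.integrable
  sq_integrable := h.sq_integrable
  ftc x hx := by rw [h.ftc x hx]; ring

theorem primitive_abs (h : IsH1On f g L) :
    IsH1On (fun x => f 0 + ∫ t in (0 : ℝ)..x, |g t|) (fun x => |g x|) L where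
  integrable := h.integrable.abs
  sq_integrable := by simpa only [sq_abs] using h.sq_integrable
  ftc x hx := by simp

theorem le_primitive_abs (h : IsH1On f g L) {x y : ℝ} (hx : x ∈ Icc 0 L) (hy : y ∈ Icc 0 L)
    (hxy : x ≤ y) : f x ≤ f 0 + ∫ t in (0 : ℝ)..y, |g t| := by
  have h0 : (0 : ℝ) ∈ Icc 0 L := ⟨le_rfl, hx.1.trans hx.2⟩
  have h1 := intervalIntegral.integral_add_adjacent_intervals
    (intervalIntegrable_of_integrableOn_Icc h.integrable.abs h0 hx)
    (intervalIntegrable_of_integrableOn_Icc h.integrable.abs hx hy)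
  have h2 : 0 ≤ ∫ t in x..y, |g t| :=
    intervalIntegral.integral_nonneg hxy fun _ _ => abs_nonneg _
  have h3 := intervalIntegral.abs_integral_le_integral_abs (f := g) (μ := volume) hx.1
  have h4 := le_abs_self (∫ t in (0 : ℝ)..x, g t)
  rw [h.ftc x hx, ← h1]
  linarith

theorem abs_sub_le_of_le (h : IsH1On f g L) {ε : ℝ} (hε : 0 < ε) {x y : ℝ} (hx : x ∈ Icc 0 L)
    (hy : y ∈ Icc 0 L) (hxy : x ≤ y) :
    |f y - f x| ≤ ε * (∫ t in (0 : ℝ)..L, g t ^ 2) + L / (4 * ε) := by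
  have hL : 0 ≤ L := hx.1.trans hx.2
  have h0 : (0 : ℝ) ∈ Icc 0 L := ⟨le_rfl, hL⟩
  have h0' : L ∈ Icc 0 L := ⟨hL, le_rfl⟩
  have hi := intervalIntegrable_of_integrableOn_Icc h.sq_integrable h0 h0'
  rw [h.sub_eq_integral hx hy]
  calc |∫ t in x..y, g t| ≤ ∫ t in x..y, |g t| :=
        intervalIntegral.abs_integral_le_integral_abs hxy
    _ ≤ ∫ t in (0 : ℝ)..L, |g t| :=
        intervalIntegral.integral_mono_interval hx.1 hxy hy.2
          (Eventually.of_forall fun _ => abs_nonneg _)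
          (intervalIntegrable_of_integrableOn_Icc h.integrable.abs h0 h0')
    _ ≤ ∫ t in (0 : ℝ)..L, (ε * g t ^ 2 + 1 / (4 * ε)) := by
        refine intervalIntegral.integral_mono_on hL
          (intervalIntegrable_of_integrableOn_Icc h.integrable.abs h0 h0')
          ((hi.const_mul ε).add intervalIntegrable_const) fun t _ => ?_
        have h1 : ε * g t ^ 2 + 1 / (4 * ε) - |g t| = (2 * ε * |g t| - 1) ^ 2 / (4 * ε) := by
          rw [← sq_abs (g t)]
          field_simp
          ring
        have h2 : 0 ≤ (2 * ε * |g t| - 1) ^ 2 / (4 * ε) := by positivity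
        linarith
    _ = _ := by
        rw [intervalIntegral.integral_add (hi.const_mul ε) intervalIntegrable_const,
          intervalIntegral.integral_const_mul, intervalIntegral.integral_const, smul_eq_mul]
        ring

theorem abs_sub_le (h : IsH1On f g L) {ε : ℝ} (hε : 0 < ε) {x y : ℝ} (hx : x ∈ Icc 0 L)
    (hy : y ∈ Icc 0 L) : |f y - f x| ≤ ε * (∫ t in (0 : ℝ)..L, g t ^ 2) + L / (4 * ε) := by
  rcases le_total x y with hxy | hxy
  · exact h.abs_sub_le_of_le hε hx hy hxy
  · rw [abs_sub_comm]
    exact h.abs_sub_le_of_le hε hy hx hxy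

theorem edgeJ_split (h : IsH1On f g L) {s : ℝ} (hs : s ∈ Icc 0 L) :
    edgeJ f g s + edgeJ (fun x => f (s + x)) (fun x => g (s + x)) (L - s) = edgeJ f g L := by
  have h0 : (0 : ℝ) ∈ Icc 0 L := ⟨le_rfl, hs.1.trans hs.2⟩
  have h0' : L ∈ Icc 0 L := ⟨hs.1.trans hs.2, le_rfl⟩
  have h1 := intervalIntegral.integral_add_adjacent_intervals
    (intervalIntegrable_of_integrableOn_Icc h.sq_integrable h0 hs)
    (intervalIntegrable_of_integrableOn_Icc h.sq_integrable hs h0')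
  have h2 := intervalIntegral.integral_add_adjacent_intervals
    (h.intervalIntegrable h0 hs) (h.intervalIntegrable hs h0')
  unfold edgeJ
  rw [intervalIntegral.integral_comp_add_left (fun x => g x ^ 2) s,
    intervalIntegral.integral_comp_add_left f s, ← h1, ← h2, add_zero, add_sub_cancel]
  ring

theorem edgeJ_add_const (h : IsH1On f g L) (hL : 0 ≤ L) (c : ℝ) :
    edgeJ (fun x => f x + c) g L = edgeJ f g L - L * c := by
  unfold edgeJ
  rw [intervalIntegral.integral_add (h.intervalIntegrable ⟨le_rfl, hL⟩ ⟨hL, le_rfl⟩)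
    intervalIntegrable_const, intervalIntegral.integral_const, smul_eq_mul]
  ring

theorem edgeJ_primitive_abs_lt (h : IsH1On f g L) (hL : 0 < L) {x : ℝ} (hx : x ∈ Icc 0 L)
    (hlt : f L < f x) :
    edgeJ (fun x => f 0 + ∫ t in (0 : ℝ)..x, |g t|) (fun x => |g x|) L < edgeJ f g L := by
  have h1 := intervalIntegral.integral_lt_integral_of_continuousOn_of_le_of_exists_lt hL
    (h.continuousOn hL.le) (h.primitive_abs.continuousOn hL.le)
    (fun y hy => h.le_primitive_abs ⟨hy.1.le, hy.2⟩ ⟨hy.1.le, hy.2⟩ le_rfl)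
    ⟨L, ⟨hL.le, le_rfl⟩, hlt.trans_le (h.le_primitive_abs hx ⟨hL.le, le_rfl⟩ hx.2)⟩
  unfold edgeJ
  simp only [sq_abs]
  linarith

end IsH1On

theorem edgeJ_reverse (f g : ℝ → ℝ) (L : ℝ) :
    edgeJ (fun x => f (L - x)) (fun x => -g (L - x)) L = edgeJ f g L := by
  unfold edgeJ
  simp only [neg_sq]
  rw [intervalIntegral.integral_comp_sub_left (fun x => g x ^ 2) L,
    intervalIntegral.integral_comp_sub_left f L, sub_self, sub_zero]

/-- `f` restricted to `[0, L]` is an injective arc-length parametrized curve. -/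
structure IsArcOn {d : ℕ} (f : ℝ → EuclideanSpace ℝ (Fin d)) (L : ℝ) : Prop where
  arclen : ∀ s t : ℝ, 0 ≤ s → s ≤ t → t ≤ L →
    eVariationOn f (Icc s t) = ENNReal.ofReal (t - s)
  inj : InjOn f (Icc 0 L)

namespace IsArcOn

variable {d : ℕ} {f : ℝ → EuclideanSpace ℝ (Fin d)} {L : ℝ}

theorem reverse (h : IsArcOn f L) : IsArcOn (fun x => f (L - x)) L where
  arclen s t hs hst ht := by
    have h1 := eVariationOn.comp_eq_of_antitoneOn f (t := Icc s t) (fun x => L - x)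
      fun _ _ _ _ hxy => sub_le_sub_left hxy _
    rw [image_const_sub_Icc, h.arclen _ _ (by linarith) (by linarith) (by linarith)] at h1
    refine h1.trans ?_
    congr 1
    ring
  inj x hx y hy hxy := by
    have := h.inj (x₁ := L - x) (x₂ := L - y) ⟨by linarith [hx.2], by linarith [hx.1]⟩
      ⟨by linarith [hy.2], by linarith [hy.1]⟩ hxy
    linarith

theorem comp_add_left (h : IsArcOn f L) {a b : ℝ} (ha : 0 ≤ a) (hb : b ≤ L) :
    IsArcOn (fun x => f (a + x)) (b - a) where
  arclen s t hs hst ht := by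
    have h1 := eVariationOn.comp_eq_of_monotoneOn f (t := Icc s t) (fun x => a + x)
      fun _ _ _ _ hxy => add_le_add_right hxy _
    rw [image_const_add_Icc, h.arclen _ _ (by linarith) (by linarith) (by linarith)] at h1
    refine h1.trans ?_
    congr 1
    ring
  inj x hx y hy hxy := by
    have := h.inj (x₁ := a + x) (x₂ := a + y) ⟨by linarith [hx.1], by linarith [hx.2]⟩
      ⟨by linarith [hy.1], by linarith [hy.2]⟩ hxy
    linarith

theorem mono (h : IsArcOn f L) {s : ℝ} (hs : s ≤ L) : IsArcOn f s where
  arclen a b ha hab hb := h.arclen a b ha hab (hb.trans hs)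
  inj := h.inj.mono (Icc_subset_Icc_right hs)

theorem of_isometry (hf : Isometry f) : IsArcOn f L where
  arclen s t _ hst _ := by
    have h1 := (monotone_id (α := ℝ)).monotoneOn (Icc s t) |>.eVariationOn_eq
      (left_mem_Icc.2 hst) (right_mem_Icc.2 hst)
    rw [inter_self] at h1
    rw [← id_eq t, ← id_eq s, ← h1]
    unfold eVariationOn
    simp only [hf.edist_eq, id_eq]
  inj := hf.injective.injOn

end IsArcOn

theorem isometry_line {d : ℕ} (p e : EuclideanSpace ℝ (Fin d)) (he : ‖e‖ = 1) :
    Isometry fun x : ℝ => p + x • e := by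
  refine Isometry.of_dist_eq fun x y => ?_
  rw [dist_add_left, dist_eq_norm, ← sub_smul, norm_smul, he, mul_one, Real.dist_eq,
    Real.norm_eq_abs]

theorem H1Fun.isH1On {G : MetricGraph} (u : H1Fun G) {a b : Fin G.N} (h : G.edge a b) :
    IsH1On (u.toFun a b) (u.deriv a b) (G.len a b) :=
  ⟨u.deriv_integrable a b h, u.deriv_sq_integrable a b h, u.ftc a b h⟩

theorem Immersion.isArcOn {G : MetricGraph} {d : ℕ} (γ : Immersion G d) {a b : Fin G.N}
    (h : G.edge a b) : IsArcOn (γ.toFun a b) (G.len a b) :=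
  ⟨γ.arclen a b h, γ.inj a b h⟩

theorem Immersion.dim_pos {G : MetricGraph} {d : ℕ} (γ : Immersion G d) {a b : Fin G.N}
    (h : G.edge a b) : ∃ e : EuclideanSpace ℝ (Fin d), ‖e‖ = 1 := by
  have hL := G.len_pos a b h
  have hne : γ.toFun a b (G.len a b) - γ.toFun a b 0 ≠ 0 := fun h0 =>
    hL.ne' (γ.inj a b h ⟨hL.le, le_rfl⟩ ⟨le_rfl, hL.le⟩ (sub_eq_zero.1 h0))
  exact ⟨_, norm_smul_inv_norm (𝕜 := ℝ) hne⟩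

theorem energyJ_eq_sum_edgeJ (G : MetricGraph) (u : H1Fun G) :
    energyJ G u = open scoped Classical in ∑ a : Fin G.N, ∑ b : Fin G.N,
      if a < b ∧ G.edge a b then edgeJ (u.toFun a b) (u.deriv a b) (G.len a b) else 0 := rfl

theorem H1Fun.apply_len {G : MetricGraph} (u : H1Fun G) {a b : Fin G.N} (h : G.edge a b) :
    u.toFun a b (G.len a b) = u.toFun b a 0 := by
  rw [u.symm a b h, sub_zero]

/-- The derivatives of `u` are compatible with the reversal of edges. -/
def H1Fun.DerivSymm {G : MetricGraph} (u : H1Fun G) : Prop :=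
  ∀ a b, G.edge a b → ∀ x, u.deriv b a x = -u.deriv a b (G.len a b - x)

open scoped Classical in
theorem H1Fun.exists_derivSymm {G : MetricGraph} (u : H1Fun G) :
    ∃ v : H1Fun G, v.toFun = u.toFun ∧ energyJ G v = energyJ G u ∧ v.DerivSymm := by
  have key : ∀ a b, G.edge a b → IsH1On (u.toFun a b)
      (if a < b then u.deriv a b else fun x => -u.deriv b a (G.len b a - x)) (G.len a b) := by
    intro a b h
    split_ifs with hab
    · exact u.isH1On h
    · have h1 := (u.isH1On (G.edge_symm a b h)).reverse (G.len_pos _ _ (G.edge_symm a b h)).le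
      rw [G.len_symm a b]
      convert h1 using 1
      funext x
      exact u.symm b a (G.edge_symm a b h) x
  refine ⟨⟨u.toFun, fun a b =>
    if a < b then u.deriv a b else fun x => -u.deriv b a (G.len b a - x), u.symm, u.vertexCont,
    fun a b h => (key a b h).integrable, fun a b h => (key a b h).sq_integrable,
    fun a b h => (key a b h).ftc⟩, rfl, ?_, ?_⟩
  · simp only [energyJ]
    refine Finset.sum_congr rfl fun a _ => Finset.sum_congr rfl fun b _ => ?_
    refine if_ctx_congr Iff.rfl (fun h => ?_) fun _ => rfl
    rw [if_pos h.1]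
  · intro a b h x
    have hne : a ≠ b := fun hab => G.edge_irrefl a (by rwa [← hab] at h)
    rcases lt_or_gt_of_ne hne with hab | hab
    · simp [hab, hab.not_gt]
    · simp [hab, hab.not_gt, G.len_symm b a]

theorem H1Fun.DerivSymm.edgeJ_symm {G : MetricGraph} {u : H1Fun G} (hu : u.DerivSymm)
    {a b : Fin G.N} (h : G.edge a b) :
    edgeJ (u.toFun b a) (u.deriv b a) (G.len b a)
      = edgeJ (u.toFun a b) (u.deriv a b) (G.len a b) := by
  rw [funext (u.symm a b h), funext (hu a b h), G.len_symm b a]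
  exact edgeJ_reverse _ _ _

open scoped Classical in
theorem sum_edges_eq_removeEdge_add (G : MetricGraph) {p q : Fin G.N} (h : G.edge p q)
    (F : Fin G.N → Fin G.N → ℝ) (hF : F q p = F p q) :
    (∑ a : Fin G.N, ∑ b : Fin G.N, if a < b ∧ G.edge a b then F a b else 0)
      = (∑ a : Fin G.N, ∑ b : Fin G.N, if a < b ∧ (G.removeEdge p q).edge a b then F a b else 0)
        + F p q := by
  have hne : p ≠ q := fun hab => G.edge_irrefl p (by rwa [← hab] at h)
  wlog hlt : p < q generalizing p q
  · have h1 := this (G.edge_symm _ _ h) hF.symm hne.symm (lt_of_le_of_ne (not_lt.1 hlt) hne.symm)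
    rw [h1, hF]
    congr 1
    refine Finset.sum_congr rfl fun a _ => Finset.sum_congr rfl fun b _ => ?_
    refine if_congr ?_ rfl rfl
    simp only [MetricGraph.removeEdge]
    tauto
  have h2 : F p q = ∑ a : Fin G.N, ∑ b : Fin G.N, if a = p ∧ b = q then F p q else 0 := by
    simp [ite_and]
  conv_rhs => rw [h2]
  rw [← Finset.sum_add_distrib]
  refine Finset.sum_congr rfl fun a _ => ?_
  rw [← Finset.sum_add_distrib]
  refine Finset.sum_congr rfl fun b _ => ?_
  simp only [MetricGraph.removeEdge]
  by_cases hab : a = p ∧ b = q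
  · obtain ⟨rfl, rfl⟩ := hab
    simp [hlt, h]
  · by_cases hba : a = q ∧ b = p
    · obtain ⟨rfl, rfl⟩ := hba
      simp [hlt.not_gt, hne.symm]
    · simp [hab, hba]

/-- Restriction of an `H¹` function to the graph without the edge `{p, q}`. -/
def H1Fun.removeEdge {G : MetricGraph} (u : H1Fun G) (p q : Fin G.N) :
    H1Fun (G.removeEdge p q) where
  toFun := u.toFun
  deriv := u.deriv
  symm a b h := u.symm a b h.1
  vertexCont a b c hb hc := u.vertexCont a b c hb.1 hc.1
  deriv_integrable a b h := u.deriv_integrable a b h.1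
  deriv_sq_integrable a b h := u.deriv_sq_integrable a b h.1
  ftc a b h := u.ftc a b h.1

theorem H1Fun.DerivSymm.removeEdge {G : MetricGraph} {u : H1Fun G} (hu : u.DerivSymm)
    (p q : Fin G.N) : (u.removeEdge p q).DerivSymm :=
  fun a b h => hu a b h.1

theorem H1Fun.DerivSymm.energyJ_eq_removeEdge_add {G : MetricGraph} {u : H1Fun G}
    (hu : u.DerivSymm) {p q : Fin G.N} (h : G.edge p q) :
    energyJ G u = energyJ (G.removeEdge p q) (u.removeEdge p q)
      + edgeJ (u.toFun p q) (u.deriv p q) (G.len p q) := by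
  rw [energyJ_eq_sum_edgeJ, energyJ_eq_sum_edgeJ, sum_edges_eq_removeEdge_add G h
    (fun a b => edgeJ (u.toFun a b) (u.deriv a b) (G.len a b)) (hu.edgeJ_symm h)]
  rfl

theorem MetricGraph.totalLength_eq_removeEdge_add (G : MetricGraph) {p q : Fin G.N}
    (h : G.edge p q) : G.totalLength = (G.removeEdge p q).totalLength + G.len p q :=
  sum_edges_eq_removeEdge_add G h G.len (G.len_symm q p)

open scoped Classical in
theorem MetricGraph.eq_of_degree_eq_one {G : MetricGraph} {j a b : Fin G.N}
    (h : G.degree j = 1) (ha : G.edge j a) (hb : G.edge j b) : a = b := by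
  unfold MetricGraph.degree at h
  rw [Finset.sum_boole, Nat.cast_id, Finset.card_eq_one] at h
  obtain ⟨c, hc⟩ := h
  have h1 : a ∈ ({c} : Finset (Fin G.N)) := hc ▸ by simpa using ha
  have h2 : b ∈ ({c} : Finset (Fin G.N)) := hc ▸ by simpa using hb
  rw [Finset.mem_singleton] at h1 h2
  rw [h1, h2]

open scoped Classical in
/-- Replacement of an `H¹` function on a pendant edge: a function on the edge `{p, q}` with the
same value at `p` may take any value at `q` when `q` has no other neighbour. -/
theorem H1Fun.exists_replace {G : MetricGraph} (u : H1Fun G) {p q : Fin G.N} (h : G.edge p q)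
    (hq : ∀ a, G.edge q a → a = p) {f g : ℝ → ℝ} (hf : IsH1On f g (G.len p q))
    (h0 : f 0 = u.toFun p q 0) (hu : u.DerivSymm) :
    ∃ v : H1Fun G, (∀ a b, G.edge a b → a ≠ q → v.toFun a b 0 = u.toFun a b 0) ∧
      energyJ G v + edgeJ (u.toFun p q) (u.deriv p q) (G.len p q)
        = energyJ G u + edgeJ f g (G.len p q) := by
  have hne : p ≠ q := fun hab => G.edge_irrefl p (by rwa [← hab] at h)
  have hL := (G.len_pos p q h).le
  have hp : ∀ a, G.edge a q → a = p := fun a ha => hq a (G.edge_symm _ _ ha)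
  let F : Fin G.N → Fin G.N → ℝ → ℝ := fun a b =>
    if b = q then f else if a = q then fun x => f (G.len p q - x) else u.toFun a b
  let F' : Fin G.N → Fin G.N → ℝ → ℝ := fun a b =>
    if b = q then g else if a = q then fun x => -g (G.len p q - x) else u.deriv a b
  have key : ∀ a b, G.edge a b → IsH1On (F a b) (F' a b) (G.len a b) := by
    intro a b hab
    by_cases hb : b = q
    · subst hb
      obtain rfl := hp a hab
      simpa [F, F'] using hf
    · by_cases ha : a = q
      · subst ha
        obtain rfl := hq b hab
        simpa [F, F', hne, G.len_symm a b] using hf.reverse hL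
      · simpa [F, F', ha, hb] using u.isH1On hab
  have hF0 : ∀ a b, G.edge a b → a ≠ q → F a b 0 = u.toFun a b 0 := by
    intro a b hab ha
    by_cases hb : b = q
    · subst hb
      obtain rfl := hp a hab
      simpa [F] using h0
    · simp [F, ha, hb]
  let v : H1Fun G :=
    { toFun := F
      deriv := F'
      symm := by
        intro a b hab x
        by_cases hb : b = q
        · subst hb
          obtain rfl := hp a hab
          simp [F, hne]
        · by_cases ha : a = q
          · subst ha
            obtain rfl := hq b hab
            simp [F, hne, G.len_symm a b]
          · simpa [F, ha, hb] using u.symm a b hab x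
      vertexCont := by
        intro a b c hb hc
        by_cases ha : a = q
        · subst ha
          rw [hq b hb, hq c hc]
        · rw [hF0 a b hb ha, hF0 a c hc ha]
          exact u.vertexCont a b c hb hc
      deriv_integrable := fun a b hab => (key a b hab).integrable
      deriv_sq_integrable := fun a b hab => (key a b hab).sq_integrable
      ftc := fun a b hab => (key a b hab).ftc }
  have hv : v.DerivSymm := by
    intro a b hab x
    by_cases hb : b = q
    · subst hb
      obtain rfl := hp a hab
      simp [v, F', hne]
    · by_cases ha : a = q
      · subst ha
        obtain rfl := hq b hab
        simp [v, F', hne, G.len_symm a b]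
      · simpa [v, F', ha, hb] using hu a b hab x
  refine ⟨v, hF0, ?_⟩
  rw [hv.energyJ_eq_removeEdge_add h, hu.energyJ_eq_removeEdge_add h]
  have huv : ∀ a b : Fin G.N, (G.removeEdge p q).edge a b →
      v.toFun a b = u.toFun a b ∧ v.deriv a b = u.deriv a b := by
    intro a b hab
    have ha : a ≠ q := by
      rintro rfl
      exact hab.2 (Or.inr ⟨rfl, hq b hab.1⟩)
    have hb : b ≠ q := by
      rintro rfl
      exact hab.2 (Or.inl ⟨hp a hab.1, rfl⟩)
    simp [v, F, F', ha, hb]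
  have h1 : energyJ (G.removeEdge p q) (v.removeEdge p q)
      = energyJ (G.removeEdge p q) (u.removeEdge p q) := by
    rw [energyJ_eq_sum_edgeJ, energyJ_eq_sum_edgeJ]
    refine Finset.sum_congr rfl fun a _ => Finset.sum_congr rfl fun b _ => ?_
    refine if_ctx_congr Iff.rfl (fun hab => ?_) fun _ => rfl
    obtain ⟨h1, h2⟩ := huv a b hab.2
    simp only [H1Fun.removeEdge, h1, h2]
  have h2 : edgeJ (v.toFun p q) (v.deriv p q) (G.len p q) = edgeJ f g (G.len p q) := by
    simp [v, F, F']
  rw [h1, h2]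
  ring

/-- The Dirichlet integral `∫_Γ |u'|²`. -/
noncomputable def H1Fun.dirichlet {G : MetricGraph} (u : H1Fun G) : ℝ :=
  open scoped Classical in ∑ a : Fin G.N, ∑ b : Fin G.N,
    if a < b ∧ G.edge a b then ∫ x in (0 : ℝ)..(G.len a b), (u.deriv a b x) ^ 2 else 0

namespace H1Fun

variable {G : MetricGraph}

open scoped Classical in
theorem dirichlet_term_nonneg (u : H1Fun G) (a b : Fin G.N) :
    0 ≤ if a < b ∧ G.edge a b then ∫ x in (0 : ℝ)..(G.len a b), (u.deriv a b x) ^ 2 else 0 := by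
  split_ifs with h
  · exact intervalIntegral.integral_nonneg (G.len_pos _ _ h.2).le fun _ _ => sq_nonneg _
  · exact le_rfl

theorem dirichlet_nonneg (u : H1Fun G) : 0 ≤ u.dirichlet :=
  Finset.sum_nonneg fun a _ => Finset.sum_nonneg fun b _ => u.dirichlet_term_nonneg a b

open scoped Classical in
theorem integral_sq_le_dirichlet (u : H1Fun G) {a b : Fin G.N} (hab : a < b) (h : G.edge a b) :
    ∫ x in (0 : ℝ)..(G.len a b), (u.deriv a b x) ^ 2 ≤ u.dirichlet := by
  have h1 := Finset.single_le_sum (fun b _ => u.dirichlet_term_nonneg a b) (Finset.mem_univ b)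
  have h2 := Finset.single_le_sum
    (fun a _ => Finset.sum_nonneg fun b (_ : b ∈ Finset.univ) => u.dirichlet_term_nonneg a b)
    (Finset.mem_univ a)
  rw [if_pos ⟨hab, h⟩] at h1
  exact h1.trans h2

theorem abs_sub_le (u : H1Fun G) {a b : Fin G.N} (h : G.edge a b) {ε : ℝ} (hε : 0 < ε) {x : ℝ}
    (hx : x ∈ Icc 0 (G.len a b)) :
    |u.toFun a b x - u.toFun a b 0| ≤ ε * u.dirichlet + G.len a b / (4 * ε) := by
  have hne : a ≠ b := fun hab => G.edge_irrefl a (by rwa [← hab] at h)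
  rcases lt_or_gt_of_ne hne with hab | hab
  · have h1 := (u.isH1On h).abs_sub_le hε ⟨le_rfl, hx.1.trans hx.2⟩ hx
    have h2 := mul_le_mul_of_nonneg_left (u.integral_sq_le_dirichlet hab h) hε.le
    linarith
  · have h' := G.edge_symm a b h
    have hl := G.len_symm a b
    have h1 := (u.isH1On h').abs_sub_le hε (x := G.len b a - 0) (y := G.len b a - x)
      ⟨by linarith [hx.1, hx.2], by linarith⟩ ⟨by linarith [hx.2], by linarith [hx.1]⟩
    have h2 := mul_le_mul_of_nonneg_left (u.integral_sq_le_dirichlet hab h') hε.le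
    rw [u.symm b a h', u.symm b a h', hl]
    linarith

theorem exists_vertex_bound (hG : G.Connected) {W : Set (Fin G.N)} (hW : W.Nonempty)
    (v : Fin G.N) {ε : ℝ} (hε : 0 < ε) :
    ∃ C : ℝ, ∀ u : H1Fun G, u.ZeroOn W → ∀ b, G.edge v b →
      |u.toFun v b 0| ≤ ε * u.dirichlet + C := by
  obtain ⟨v₀, hv₀⟩ := hW
  induction hG.2 v₀ v generalizing ε with
  | refl =>
    refine ⟨0, fun u hu b hb => ?_⟩
    rw [hu v₀ hv₀ b hb, abs_zero, add_zero]
    exact mul_nonneg hε.le u.dirichlet_nonneg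
  | @tail a c _ hac ih =>
    obtain ⟨C, hC⟩ := ih (half_pos hε)
    refine ⟨C + G.len a c / (4 * (ε / 2)), fun u hu b hb => ?_⟩
    have hca := G.edge_symm _ _ hac
    have h1 := hC u hu c hac
    have h2 := u.abs_sub_le hac (half_pos hε) (x := G.len a c) ⟨(G.len_pos _ _ hac).le, le_rfl⟩
    rw [u.apply_len hac] at h2
    rw [u.vertexCont c b a hb hca]
    have h3 := abs_add_le (u.toFun c a 0 - u.toFun a c 0) (u.toFun a c 0)
    rw [sub_add_cancel] at h3
    linarith

theorem exists_integral_bound (hG : G.Connected) {W : Set (Fin G.N)} (hW : W.Nonempty)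
    {ε : ℝ} (hε : 0 < ε) (a b : Fin G.N) :
    ∃ C : ℝ, 0 ≤ C ∧ ∀ u : H1Fun G, u.ZeroOn W → G.edge a b →
      ∫ x in (0 : ℝ)..(G.len a b), u.toFun a b x ≤ ε * u.dirichlet + C := by
  by_cases h : G.edge a b
  swap
  · exact ⟨0, le_rfl, fun _ _ h' => absurd h' h⟩
  have hL := G.len_pos a b h
  have hδ : 0 < ε / (2 * G.len a b) := by positivity
  obtain ⟨C, hC⟩ := exists_vertex_bound hG hW a hδ
  refine ⟨|G.len a b * (C + G.len a b / (4 * (ε / (2 * G.len a b))))|, abs_nonneg _,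
    fun u hu _ => ?_⟩
  have h1 : ∀ x ∈ Icc 0 (G.len a b), u.toFun a b x ≤ 2 * (ε / (2 * G.len a b)) * u.dirichlet
      + (C + G.len a b / (4 * (ε / (2 * G.len a b)))) := by
    intro x hx
    have h2 := hC u hu b h
    have h3 := u.abs_sub_le h hδ hx
    have h4 := le_abs_self (u.toFun a b 0)
    have h5 := le_abs_self (u.toFun a b x - u.toFun a b 0)
    linarith
  have h2 := intervalIntegral.integral_mono_on hL.le
    ((u.isH1On h).intervalIntegrable ⟨le_rfl, hL.le⟩ ⟨hL.le, le_rfl⟩)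
    intervalIntegrable_const h1
  rw [intervalIntegral.integral_const, smul_eq_mul, sub_zero, mul_add] at h2
  have h3 : G.len a b * (2 * (ε / (2 * G.len a b)) * u.dirichlet) = ε * u.dirichlet := by
    field_simp
  rw [h3] at h2
  exact h2.trans (add_le_add_right (le_abs_self _) _)

end H1Fun

open scoped Classical in
/-- The functional `J` is bounded below on a connected graph with a Dirichlet vertex. -/
theorem MetricGraph.Connected.bddBelow_energyJ {G : MetricGraph} (hG : G.Connected)
    {W : Set (Fin G.N)} (hW : W.Nonempty) :
    BddBelow {e : ℝ | ∃ u : H1Fun G, u.ZeroOn W ∧ energyJ G u = e} := by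
  have hN : (0 : ℝ) < G.N := Nat.cast_pos.2 hG.1
  have hε : (0 : ℝ) < 1 / (2 * G.N ^ 2) := by positivity
  choose C hC0 hC using H1Fun.exists_integral_bound hG hW hε
  refine ⟨-∑ a, ∑ b, C a b, ?_⟩
  rintro _ ⟨u, hu, rfl⟩
  have h1 : energyJ G u = (1 / 2) * u.dirichlet - ∑ a : Fin G.N, ∑ b : Fin G.N,
      if a < b ∧ G.edge a b then ∫ x in (0 : ℝ)..(G.len a b), u.toFun a b x else 0 := by
    unfold energyJ H1Fun.dirichlet
    simp only [Finset.mul_sum, ← Finset.sum_sub_distrib]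
    refine Finset.sum_congr rfl fun a _ => Finset.sum_congr rfl fun b _ => ?_
    split_ifs <;> simp
  have h2 : (∑ a : Fin G.N, ∑ b : Fin G.N,
      if a < b ∧ G.edge a b then ∫ x in (0 : ℝ)..(G.len a b), u.toFun a b x else 0)
      ≤ ∑ a : Fin G.N, ∑ b : Fin G.N, (1 / (2 * (G.N : ℝ) ^ 2) * u.dirichlet + C a b) := by
    refine Finset.sum_le_sum fun a _ => Finset.sum_le_sum fun b _ => ?_
    split_ifs with h
    · exact hC a b u hu h.2
    · exact add_nonneg (mul_nonneg hε.le u.dirichlet_nonneg) (hC0 a b)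
  simp only [Finset.sum_add_distrib, Finset.sum_const, Finset.card_univ, Fintype.card_fin,
    nsmul_eq_mul] at h2
  have h3 : (G.N : ℝ) * (G.N * (1 / (2 * (G.N : ℝ) ^ 2) * u.dirichlet)) = 1 / 2 * u.dirichlet := by
    field_simp
  rw [h3] at h2
  rw [h1]
  linarith

/-- Extension of a table indexed by `Fin n` by a last row `q`, a last column `p` and a corner
entry `z`. -/
def extendTable {α : Type*} {n : ℕ} (f : Fin n → Fin n → α) (p q : Fin n → α) (z : α)
    (a b : Fin (n + 1)) : α :=
  Fin.lastCases (motive := fun _ => α)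
    (Fin.lastCases (motive := fun _ => α) z q b)
    (fun a => Fin.lastCases (motive := fun _ => α) (p a) (f a) b) a

section extendTable

variable {α : Type*} {n : ℕ} (f : Fin n → Fin n → α) (p q : Fin n → α) (z : α)

@[simp]
theorem extendTable_castSucc_castSucc (a b : Fin n) :
    extendTable f p q z a.castSucc b.castSucc = f a b := by
  simp [extendTable]

@[simp]
theorem extendTable_castSucc_last (a : Fin n) :
    extendTable f p q z a.castSucc (Fin.last n) = p a := by
  simp [extendTable]

@[simp]
theorem extendTable_last_castSucc (b : Fin n) :
    extendTable f p q z (Fin.last n) b.castSucc = q b := by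
  simp [extendTable]

@[simp]
theorem extendTable_last_last : extendTable f p q z (Fin.last n) (Fin.last n) = z := by
  simp [extendTable]

end extendTable

theorem Fin.forall_forall_succ_iff_castSucc {n : ℕ} {P : Fin (n + 1) → Fin (n + 1) → Prop} :
    (∀ a b, P a b) ↔ (∀ a b : Fin n, P a.castSucc b.castSucc) ∧
      (∀ a : Fin n, P a.castSucc (Fin.last n)) ∧ (∀ b : Fin n, P (Fin.last n) b.castSucc) ∧
      P (Fin.last n) (Fin.last n) := by
  simp only [Fin.forall_fin_succ']
  constructor
  · rintro ⟨h1, h2, h3⟩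
    exact ⟨fun a b => (h1 a).1 b, fun a => (h1 a).2, h2, h3⟩
  · rintro ⟨h1, h2, h3, h4⟩
    exact ⟨fun a => ⟨h1 a, h2 a⟩, h3, h4⟩

/-- The graph obtained by adding a new (last) vertex, joined to every vertex `a ∈ A` by an edge
of length `r a`. -/
@[reducible]
def MetricGraph.addVertex (G : MetricGraph) (A : Set (Fin G.N)) (r : Fin G.N → ℝ)
    (hr : ∀ a ∈ A, 0 < r a) : MetricGraph where
  N := G.N + 1
  edge := extendTable G.edge (· ∈ A) (· ∈ A) False
  edge_symm := by
    rw [Fin.forall_forall_succ_iff_castSucc]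
    simpa using G.edge_symm
  edge_irrefl a := by
    induction a using Fin.lastCases with
    | last => simp
    | cast a => simpa using G.edge_irrefl a
  len := extendTable G.len r r 0
  len_symm := by
    rw [Fin.forall_forall_succ_iff_castSucc]
    simpa using G.len_symm
  len_pos := by
    rw [Fin.forall_forall_succ_iff_castSucc]
    simpa using ⟨G.len_pos, hr⟩

section addVertex

variable {G : MetricGraph} {A : Set (Fin G.N)} {r : Fin G.N → ℝ} {hr : ∀ a ∈ A, 0 < r a}

open scoped Classical in
theorem sum_edges_addVertex (F : Fin (G.N + 1) → Fin (G.N + 1) → ℝ) :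
    (∑ a : Fin (G.N + 1), ∑ b : Fin (G.N + 1),
      if a < b ∧ (G.addVertex A r hr).edge a b then F a b else 0)
      = (∑ a : Fin G.N, ∑ b : Fin G.N,
          if a < b ∧ G.edge a b then F a.castSucc b.castSucc else 0)
        + ∑ a : Fin G.N, if a ∈ A then F a.castSucc (Fin.last G.N) else 0 := by
  simp [Fin.sum_univ_castSucc, Finset.sum_add_distrib, Fin.castSucc_lt_last,
    (Fin.castSucc_lt_last _).not_gt]

open scoped Classical in
theorem MetricGraph.totalLength_addVertex :
    (G.addVertex A r hr).totalLength = G.totalLength + ∑ a : Fin G.N, if a ∈ A then r a else 0 := by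
  have h := sum_edges_addVertex (hr := hr) (extendTable G.len r r 0)
  simp only [extendTable_castSucc_castSucc, extendTable_castSucc_last] at h
  exact h

open scoped Classical in
/-- Extension of an `H¹` function to a new vertex. The function on the edge from the new vertex
to `a` is `f a`. -/
theorem H1Fun.exists_addVertex (u : H1Fun G) (f g : Fin G.N → ℝ → ℝ) (c : ℝ)
    (hfg : ∀ a ∈ A, IsH1On (f a) (g a) (r a)) (hc : ∀ a ∈ A, f a 0 = c)
    (hu : ∀ a ∈ A, ∀ b, G.edge a b → f a (r a) = u.toFun a b 0) :
    ∃ v : H1Fun (G.addVertex A r hr),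
      (∀ a b, G.edge a b → v.toFun a.castSucc b.castSucc = u.toFun a b) ∧
      (∀ a, v.toFun a.castSucc (Fin.last G.N) 0 = f a (r a)) ∧
      energyJ (G.addVertex A r hr) v = energyJ G u
        + ∑ a : Fin G.N, if a ∈ A then edgeJ (f a) (g a) (r a) else 0 := by
  let F := extendTable u.toFun (fun a x => f a (r a - x)) f 0
  let F' := extendTable u.deriv (fun a x => -g a (r a - x)) g 0
  have key : ∀ a b, (G.addVertex A r hr).edge a b →
      IsH1On (F a b) (F' a b) ((G.addVertex A r hr).len a b) := by
    rw [Fin.forall_forall_succ_iff_castSucc]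
    simp only [F, F', extendTable_castSucc_castSucc, extendTable_castSucc_last,
      extendTable_last_castSucc, extendTable_last_last]
    exact ⟨fun a b h => u.isH1On h, fun a ha => (hfg a ha).reverse (hr a ha).le, hfg, False.elim⟩
  refine ⟨⟨F, F', ?_, ?_, fun a b h => (key a b h).integrable,
    fun a b h => (key a b h).sq_integrable, fun a b h => (key a b h).ftc⟩, ?_, ?_, ?_⟩
  · rw [Fin.forall_forall_succ_iff_castSucc]
    simpa [F] using u.symm
  · intro a b c'
    induction a using Fin.lastCases with
    | last =>
      induction b using Fin.lastCases with
      | last => simp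
      | cast b =>
        induction c' using Fin.lastCases with
        | last => simp
        | cast c' =>
          simp only [F, extendTable_last_castSucc]
          intro hb hc'
          rw [hc b hb, hc c' hc']
    | cast a =>
      induction b using Fin.lastCases with
      | last =>
        induction c' using Fin.lastCases with
        | last => simp
        | cast c' =>
          simp only [F, extendTable_castSucc_castSucc, extendTable_castSucc_last, sub_zero]
          exact fun hb hc' => hu a hb c' hc'
      | cast b =>
        induction c' using Fin.lastCases with
        | last =>
          simp only [F, extendTable_castSucc_castSucc, extendTable_castSucc_last, sub_zero]
          exact fun hb hc' => (hu a hc' b hb).symm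
        | cast c' =>
          simp only [F, extendTable_castSucc_castSucc]
          exact u.vertexCont a b c'
  · simp [F]
  · simp [F]
  · have h := sum_edges_addVertex (hr := hr)
      fun a b => edgeJ (F a b) (F' a b) ((G.addVertex A r hr).len a b)
    simp only [F, F', extendTable_castSucc_castSucc, extendTable_castSucc_last, edgeJ_reverse] at h
    exact h

/-- Extension of an immersion to a new vertex. The curve from the new vertex to `a` is `f a`. The
positions `y` of the old vertices may change where no old edge is affected. -/
theorem Immersion.exists_addVertex {d : ℕ} (γ : Immersion G d)
    (y : Fin G.N → EuclideanSpace ℝ (Fin d)) (p : EuclideanSpace ℝ (Fin d))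
    (f : Fin G.N → ℝ → EuclideanSpace ℝ (Fin d))
    (hy : ∀ a b, G.edge a b → γ.vpos a = y a) (hf : ∀ a ∈ A, IsArcOn (f a) (r a))
    (hp : ∀ a ∈ A, f a 0 = p) (hfy : ∀ a ∈ A, f a (r a) = y a) :
    ∃ γ' : Immersion (G.addVertex A r hr) d, ∀ a : Fin G.N, γ'.vpos a.castSucc = y a := by
  let F := extendTable γ.toFun (fun a x => f a (r a - x)) f 0
  have key : ∀ a b, (G.addVertex A r hr).edge a b →
      IsArcOn (F a b) ((G.addVertex A r hr).len a b) := by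
    rw [Fin.forall_forall_succ_iff_castSucc]
    simp only [F, extendTable_castSucc_castSucc, extendTable_castSucc_last,
      extendTable_last_castSucc, extendTable_last_last]
    exact ⟨fun a b h => γ.isArcOn h, fun a ha => (hf a ha).reverse, hf, False.elim⟩
  refine ⟨⟨F, Fin.lastCases (motive := fun _ => EuclideanSpace ℝ (Fin d)) p y, ?_, ?_,
    fun a b h => (key a b h).arclen, fun a b h => (key a b h).inj⟩, ?_⟩
  · rw [Fin.forall_forall_succ_iff_castSucc]
    simp only [F, extendTable_castSucc_castSucc, extendTable_castSucc_last,
      extendTable_last_castSucc, extendTable_last_last, Fin.lastCases_castSucc,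
      Fin.lastCases_last, sub_zero]
    exact ⟨fun a b h => (γ.start a b h).trans (hy a b h), hfy, hp, False.elim⟩
  · rw [Fin.forall_forall_succ_iff_castSucc]
    simpa [F] using γ.symm
  · simp

end addVertex

/-- Restriction of an immersion to the graph without the edge `{p, q}`. -/
def Immersion.removeEdge {G : MetricGraph} {d : ℕ} (γ : Immersion G d) (p q : Fin G.N) :
    Immersion (G.removeEdge p q) d where
  toFun := γ.toFun
  vpos := γ.vpos
  start a b h := γ.start a b h.1
  symm a b h := γ.symm a b h.1
  arclen a b h := γ.arclen a b h.1
  inj a b h := γ.inj a b h.1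

open scoped Classical in
theorem sum_ite_mem_triple {n : ℕ} {A : Set (Fin n)} {a b c : Fin n} (hA : A = {a, b, c})
    (hab : a ≠ b) (hac : a ≠ c) (hbc : b ≠ c) (F : Fin n → ℝ) :
    (∑ x : Fin n, if x ∈ A then F x else 0) = F a + (F b + F c) := by
  have h : ∀ x : Fin n, x ∈ A ↔ x ∈ ({a, b, c} : Finset (Fin n)) := by
    simp [hA]
  simp only [h, Finset.sum_ite_mem, Finset.univ_inter]
  rw [Finset.sum_insert (by simp [hab, hac]), Finset.sum_pair hbc]

section regraft

variable {G : MetricGraph} {i i' j j' : Fin G.N}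

/-- The graph without the edges `{i, i'}` and `{j, j'}`. -/
@[reducible]
def MetricGraph.removeTwoEdges (G : MetricGraph) (i i' j j' : Fin G.N) : MetricGraph where
  N := G.N
  edge a b := (G.edge a b ∧ ¬((a = i ∧ b = i') ∨ (a = i' ∧ b = i))) ∧
    ¬((a = j ∧ b = j') ∨ (a = j' ∧ b = j))
  edge_symm := ((G.removeEdge i i').removeEdge j j').edge_symm
  edge_irrefl := ((G.removeEdge i i').removeEdge j j').edge_irrefl
  len := G.len
  len_symm := G.len_symm
  len_pos := ((G.removeEdge i i').removeEdge j j').len_pos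

/-- The graph obtained by removing the edges `{i, i'}` and `{j, j'}` and joining `i`, `i'` and `j`
to a new vertex by edges of lengths `r i`, `r i'` and `r j`. -/
@[reducible]
def MetricGraph.regraft (G : MetricGraph) (i i' j j' : Fin G.N) (r : Fin G.N → ℝ)
    (hr : ∀ a ∈ ({i, i', j} : Set (Fin G.N)), 0 < r a) : MetricGraph :=
  (G.removeTwoEdges i i' j j').addVertex {i, i', j} r hr

/-- Regrafting a pendant edge `{j, j'}` preserves connectedness. -/
theorem MetricGraph.Connected.regraft (hG : G.Connected) (hj : ∀ a, G.edge j a → a = j')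
    {r : Fin G.N → ℝ} (hr : ∀ a ∈ ({i, i', j} : Set (Fin G.N)), 0 < r a)
    (hij : i ≠ j) (hj' : G.edge j j') : (G.regraft i i' j j' r hr).Connected := by
  let A : Set (Fin G.N) := {i, i', j}
  let E : Fin (G.N + 1) → Fin (G.N + 1) → Prop :=
    extendTable (G.removeTwoEdges i i' j j').edge (· ∈ A) (· ∈ A) False
  have hEs : Std.Symm (Relation.ReflTransGen E) :=
    have : Std.Symm E := ⟨(G.regraft i i' j j' r hr).edge_symm⟩
    Relation.ReflTransGen.stdSymm
  have hlast : ∀ a ∈ A, E (Fin.last G.N) a.castSucc := fun a ha => 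
    (extendTable_last_castSucc _ _ _ _ a).mpr ha
  have hlast' : ∀ a ∈ A, E a.castSucc (Fin.last G.N) := fun a ha => 
    (extendTable_castSucc_last _ _ _ _ a).mpr ha
  have hne : j' ≠ j := fun h => G.edge_irrefl j (by rwa [h] at hj')
  let φ : Fin G.N → Fin (G.N + 1) := fun a => if a = j then j'.castSucc else a.castSucc
  have hφ : ∀ a b, G.edge a b → Relation.ReflTransGen E (φ a) (φ b) := by
    intro a b hab
    by_cases ha : a = j
    · subst ha
      obtain rfl := hj b hab
      simpa [φ, hne] using Relation.ReflTransGen.refl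
    by_cases hb : b = j
    · subst hb
      obtain rfl := hj a (G.edge_symm _ _ hab)
      simpa [φ, hne] using Relation.ReflTransGen.refl
    simp only [φ, ha, hb, if_false]
    by_cases h1 : a = i ∧ b = i'
    · obtain ⟨rfl, rfl⟩ := h1
      exact (Relation.ReflTransGen.single (hlast' a (by simp [A]))).tail (hlast b (by simp [A]))
    by_cases h2 : a = i' ∧ b = i
    · obtain ⟨rfl, rfl⟩ := h2
      exact (Relation.ReflTransGen.single (hlast' a (by simp [A]))).tail (hlast b (by simp [A]))
    refine Relation.ReflTransGen.single ?_
    simp only [E, extendTable_castSucc_castSucc]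
    tauto
  have hφ' : ∀ a b, Relation.ReflTransGen E (φ a) (φ b) := by
    intro a b
    induction hG.2 a b with
    | refl => exact Relation.ReflTransGen.refl
    | tail _ h ih => exact ih.trans (hφ _ _ h)
  have hroot : ∀ a, Relation.ReflTransGen E (Fin.last G.N) a := by
    intro a
    induction a using Fin.lastCases with
    | last => exact Relation.ReflTransGen.refl
    | cast a =>
      by_cases ha : a = j
      · rw [ha]
        exact Relation.ReflTransGen.single (hlast j (by simp [A]))
      · have h1 := hφ' i a
        simp only [φ, hij, ha, if_false] at h1
        exact (Relation.ReflTransGen.single (hlast i (by simp [A]))).trans h1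
  exact ⟨Nat.succ_pos _, fun a b =>
    (hEs.symm _ _ (hroot a)).trans (hroot b)⟩

open scoped Classical in
theorem MetricGraph.totalLength_regraft (hii' : G.edge i i') (hjj' : G.edge j j') (hij : i ≠ j)
    (hi'j : i' ≠ j) {r : Fin G.N → ℝ} (hr : ∀ a ∈ ({i, i', j} : Set (Fin G.N)), 0 < r a)
    (hlen : r i + r i' = G.len i i') (hlen' : r j = G.len j j') :
    (G.regraft i i' j j' r hr).totalLength = G.totalLength := by
  have hne : i ≠ i' := fun h => G.edge_irrefl i (by rwa [← h] at hii')
  have hjj'' : (G.removeEdge i i').edge j j' := ⟨hjj', by simp [hij.symm, hi'j.symm]⟩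
  have h1 := (G.removeEdge i i').totalLength_eq_removeEdge_add hjj''
  have h2 : (G.regraft i i' j j' r hr).totalLength
      = ((G.removeEdge i i').removeEdge j j').totalLength + (r i + (r i' + r j)) := by
    refine MetricGraph.totalLength_addVertex.trans (congrArg _ ?_)
    exact sum_ite_mem_triple rfl hne hij hi'j r
  rw [h2, G.totalLength_eq_removeEdge_add hii', h1, ← hlen]
  change _ = _ + G.len j j' + _
  rw [← hlen']
  ring

/-- Restriction of an `H¹` function to the graph without the edges `{i, i'}` and `{j, j'}`. -/
def H1Fun.removeTwoEdges (u : H1Fun G) (i i' j j' : Fin G.N) :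
    H1Fun (G.removeTwoEdges i i' j j') :=
  (u.removeEdge i i').removeEdge (G := G.removeEdge i i') j j'

theorem H1Fun.DerivSymm.energyJ_eq_removeTwoEdges_add {u : H1Fun G} (hu : u.DerivSymm)
    (hii' : G.edge i i') (hjj' : G.edge j j') (hij : i ≠ j) (hi'j : i' ≠ j) :
    energyJ G u = energyJ (G.removeTwoEdges i i' j j') (u.removeTwoEdges i i' j j')
      + edgeJ (u.toFun j j') (u.deriv j j') (G.len j j')
      + edgeJ (u.toFun i i') (u.deriv i i') (G.len i i') := by
  have hjj'' : (G.removeEdge i i').edge j j' := ⟨hjj', by simp [hij.symm, hi'j.symm]⟩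
  rw [hu.energyJ_eq_removeEdge_add hii', (hu.removeEdge i i').energyJ_eq_removeEdge_add hjj'']
  rfl

/-- Restriction of an immersion to the graph without the edges `{i, i'}` and `{j, j'}`. -/
def Immersion.removeTwoEdges {d : ℕ} (γ : Immersion G d) (i i' j j' : Fin G.N) :
    Immersion (G.removeTwoEdges i i' j j') d :=
  (γ.removeEdge i i').removeEdge (G := G.removeEdge i i') j j'

/-- If `w` takes a larger value in the interior of an edge `{i, i'}` than at the free end `j` of a
pendant edge, then cutting that edge off and gluing its free end to the point on `{i, i'}` yields
an admissible graph with strictly smaller `J`. -/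
theorem exists_regraft_energyJ_lt {d : ℕ} (hG : G.Connected) (γ : Immersion G d)
    {V : Set (Fin G.N)} {w : H1Fun G} (hw0 : w.ZeroOn V) (hw : w.DerivSymm) (hjV : j ∉ V)
    (hii' : G.edge i i') (hjj' : G.edge j j') (hj : ∀ a, G.edge j a → a = j')
    (hij : i ≠ j) (hi'j : i' ≠ j) {s : ℝ} (hs : s ∈ Ioo 0 (G.len i i'))
    (hlt : w.toFun j j' 0 < w.toFun i i' s) :
    ∃ (K : MetricGraph) (W : Set (Fin K.N)) (η : Immersion K d) (v : H1Fun K),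
      K.Connected ∧ K.totalLength = G.totalLength ∧ η.vpos '' W = γ.vpos '' V ∧
      v.ZeroOn W ∧ energyJ K v < energyJ G w := by
  have hne : i ≠ i' := fun h => G.edge_irrefl i (by rwa [← h] at hii')
  have hL := G.len_pos j j' hjj'
  have hHG : ∀ a b : Fin G.N, (G.removeTwoEdges i i' j j').edge a b → G.edge a b :=
    fun a b h => h.1.1
  have hHj : ∀ b : Fin G.N, ¬ (G.removeTwoEdges i i' j j').edge j b :=
    fun b h => h.2 (Or.inl ⟨rfl, hj b h.1.1⟩)
  let A : Set (Fin G.N) := {i, i', j}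
  let r : Fin G.N → ℝ := fun a =>
    if a = i then s else if a = i' then G.len i i' - s else G.len j j'
  have hA : ∀ {P : Fin G.N → Prop}, P i → P i' → P j → ∀ a ∈ A, P a := by
    rintro P h1 h2 h3 a (rfl | rfl | rfl)
    exacts [h1, h2, h3]
  have ri : r i = s := by simp [r]
  have ri' : r i' = G.len i i' - s := by simp [r, hne.symm]
  have rj : r j = G.len j j' := by simp [r, hij.symm, hi'j.symm]
  have hr : ∀ a ∈ A, 0 < r a :=
    hA (by rw [ri]; exact hs.1) (by rw [ri']; exact sub_pos.2 hs.2) (by rw [rj]; exact hL)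
  let f : Fin G.N → ℝ → ℝ := fun a =>
    if a = i then fun x => w.toFun i i' (s - x) else if a = i' then fun x => w.toFun i i' (s + x)
    else fun x => w.toFun j j' x + (w.toFun i i' s - w.toFun j j' 0)
  let g : Fin G.N → ℝ → ℝ := fun a =>
    if a = i then fun x => -w.deriv i i' (s - x) else if a = i' then fun x => w.deriv i i' (s + x)
    else w.deriv j j'
  have fi : f i = fun x => w.toFun i i' (s - x) := by simp [f]
  have fi' : f i' = fun x => w.toFun i i' (s + x) := by simp [f, hne.symm]
  have fj : f j = fun x => w.toFun j j' x + (w.toFun i i' s - w.toFun j j' 0) := by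
    simp [f, hij.symm, hi'j.symm]
  have gi : g i = fun x => -w.deriv i i' (s - x) := by simp [g]
  have gi' : g i' = fun x => w.deriv i i' (s + x) := by simp [g, hne.symm]
  have gj : g j = w.deriv j j' := by simp [g, hij.symm, hi'j.symm]
  have hi := w.isH1On hii'
  have hjH := w.isH1On hjj'
  have fri : f i (r i) = w.toFun i i' 0 := by rw [fi, ri]; simp
  have fri' : f i' (r i') = w.toFun i' i 0 := by
    rw [fi', ri', ← w.apply_len hii']
    simp
  obtain ⟨v, hv1, hv2, hv3⟩ :=
    H1Fun.exists_addVertex (G := G.removeTwoEdges i i' j j')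
      (w.removeTwoEdges i i' j j') (A := A) (r := r) (hr := hr)
      f g (w.toFun i i' s)
      (hA (by rw [fi, gi, ri]; exact (hi.mono hs.2.le).reverse hs.1.le)
        (by rw [fi', gi', ri']; exact hi.comp_add_left hs.1.le hs.2.le le_rfl)
        (by rw [fj, gj, rj]; exact hjH.add_const _))
      (hA (by rw [fi]; simp) (by rw [fi']; simp) (by rw [fj]; simp))
      (hA (fun b hb => fri.trans (w.vertexCont i i' b hii' (hHG _ _ hb)))
        (fun b hb => fri'.trans (w.vertexCont i' i b (G.edge_symm _ _ hii') (hHG _ _ hb)))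
        (fun b hb => absurd hb (hHj b)))
  obtain ⟨e, he⟩ := γ.dim_pos hjj'
  let y : Fin G.N → EuclideanSpace ℝ (Fin d) :=
    Function.update γ.vpos j (γ.toFun i i' s + G.len j j' • e)
  have hy : ∀ a, a ≠ j → y a = γ.vpos a := fun a ha => Function.update_of_ne ha _ _
  let c : Fin G.N → ℝ → EuclideanSpace ℝ (Fin d) := fun a =>
    if a = i then fun x => γ.toFun i i' (s - x) else if a = i' then fun x => γ.toFun i i' (s + x)
    else fun x => γ.toFun i i' s + x • e
  have ci : c i = fun x => γ.toFun i i' (s - x) := by simp [c]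
  have ci' : c i' = fun x => γ.toFun i i' (s + x) := by simp [c, hne.symm]
  have cj : c j = fun x => γ.toFun i i' s + x • e := by simp [c, hij.symm, hi'j.symm]
  have hγi := γ.isArcOn hii'
  obtain ⟨η, hη⟩ :=
    Immersion.exists_addVertex (G := G.removeTwoEdges i i' j j')
      (γ.removeTwoEdges i i' j j') (A := A) (r := r) (hr := hr)
      y (γ.toFun i i' s) c
      (fun a b hab => (hy a (fun h => hHj b (h ▸ hab))).symm)
      (hA (by rw [ci, ri]; exact (hγi.mono hs.2.le).reverse)
        (by rw [ci', ri']; exact hγi.comp_add_left hs.1.le le_rfl)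
        (by rw [cj]; exact IsArcOn.of_isometry (isometry_line _ _ he)))
      (hA (by rw [ci]; simp) (by rw [ci']; simp) (by rw [cj]; simp))
      (hA (by rw [ci, ri, hy i hij, ← γ.start i i' hii']; simp)
        (by
          rw [ci', ri', hy i' hi'j, ← γ.start i' i (G.edge_symm _ _ hii'), γ.symm i i' hii']
          simp)
        (by rw [cj, rj]; simp [y]))
  refine ⟨G.regraft i i' j j' r hr, Fin.castSucc '' V, η, v, hG.regraft hj hr hij hjj',
    MetricGraph.totalLength_regraft hii' hjj' hij hi'j hr (by rw [ri, ri']; ring) rj, ?_, ?_, ?_⟩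
  · rw [image_image]
    refine image_congr fun a ha => ?_
    rw [hη a, hy a (fun h => hjV (h ▸ ha))]
  · rintro _ ⟨a, ha, rfl⟩ b
    induction b using Fin.lastCases with
    | last =>
      intro hb
      have haA : a ∈ A := (extendTable_castSucc_last _ _ _ _ a).mp hb
      rw [hv2 a]
      refine hA (P := fun a => a ∈ V → f a (r a) = 0) (fun h => ?_) (fun h => ?_)
        (fun h => absurd h hjV) a haA ha
      · rw [fri]
        exact hw0 i h i' hii'
      · rw [fri']
        exact hw0 i' h i (G.edge_symm _ _ hii')
    | cast b =>
      intro hb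
      have hab : (G.removeTwoEdges i i' j j').edge a b :=
        (extendTable_castSucc_castSucc _ _ _ _ a b).mp hb
      rw [hv1 a b hab]
      exact hw0 a ha b (hHG a b hab)
  · have hJ := hw.energyJ_eq_removeTwoEdges_add hii' hjj' hij hi'j
    have h1 := sum_ite_mem_triple (A := A) rfl hne hij hi'j fun a => edgeJ (f a) (g a) (r a)
    have h2 := hi.edgeJ_split (s := s) ⟨hs.1.le, hs.2.le⟩
    have h3 := hjH.edgeJ_add_const hL.le (w.toFun i i' s - w.toFun j j' 0)
    have h4 := edgeJ_reverse (w.toFun i i') (w.deriv i i') s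
    rw [fi, fi', fj, gi, gi', gj, ri, ri', rj, h3, h4] at h1
    have h5 := mul_pos hL (sub_pos.2 hlt)
    rw [hv3, hJ, h1]
    linarith

end regraft

/-- On a pendant edge `{p, q}` a minimizer is bounded by its value at the free end `q`. -/
theorem H1Fun.le_of_pendant {G : MetricGraph} {V : Set (Fin G.N)} {w : H1Fun G}
    (hw0 : w.ZeroOn V) (hw : w.DerivSymm)
    (hmin : ∀ u : H1Fun G, u.ZeroOn V → energyJ G w ≤ energyJ G u) {p q : Fin G.N}
    (h : G.edge p q) (hq : ∀ a, G.edge q a → a = p) (hqV : q ∉ V) {x : ℝ}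
    (hx : x ∈ Icc 0 (G.len p q)) : w.toFun p q x ≤ w.toFun q p 0 := by
  by_contra! hlt
  rw [← w.apply_len h] at hlt
  have h1 := w.isH1On h
  obtain ⟨v, hv0, hv⟩ := w.exists_replace h hq h1.primitive_abs (by simp) hw
  have h2 := h1.edgeJ_primitive_abs_lt (G.len_pos p q h) hx hlt
  have h3 := hmin v fun a ha b hab => by
    rw [hv0 a b hab (fun h' => hqV (h' ▸ ha))]
    exact hw0 a ha b hab
  linarith

/-- If `(Γ, 𝒱, γ)` solves problem (enim) and `w` is the energy function
of `Γ` with Dirichlet conditions in `𝒱`, then `w` attains its maximum over `Γ` at any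
Neumann vertex, i.e. at any vertex of degree one not belonging to `𝒱`. -/
theorem energy_function_max_at_neumann_vertex {d k : ℕ} (hk : 0 < k)
    (D : Fin k → EuclideanSpace ℝ (Fin d)) (hD : Function.Injective D)
    (l : ℝ) (hl : SteinerLen (Set.range D) ≤ l)
    (G : MetricGraph) (V : Set (Fin G.N)) (γ : Immersion G d)
    (hGc : G.Connected) (hGl : G.totalLength = l) (hγ : γ.vpos '' V = Set.range D)
    (hmin : ∀ (G' : MetricGraph) (V' : Set (Fin G'.N)) (γ' : Immersion G' d),
      G'.Connected → G'.totalLength = l → γ'.vpos '' V' = Set.range D →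
      dirEnergy G V ≤ dirEnergy G' V')
    (w : H1Fun G) (hw0 : w.ZeroOn V)
    (hwmin : ∀ u : H1Fun G, u.ZeroOn V → energyJ G w ≤ energyJ G u)
    (j : Fin G.N) (hjdeg : G.degree j = 1) (hjV : j ∉ V) :
    ∀ j', G.edge j j' → ∀ i i', G.edge i i' →
      ∀ x ∈ Set.Icc (0 : ℝ) (G.len i i'), w.toFun i i' x ≤ w.toFun j j' 0 := by
  have hVne : ∀ {K : MetricGraph} {W : Set (Fin K.N)} (η : Immersion K d),
      η.vpos '' W = Set.range D → W.Nonempty := by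
    intro K W η h
    have : (η.vpos '' W).Nonempty := h ▸ ⟨D ⟨0, hk⟩, mem_range_self _⟩
    exact this.of_image
  obtain ⟨w', hw', hJ, hsymm⟩ := w.exists_derivSymm
  have hw'0 : w'.ZeroOn V := by
    unfold H1Fun.ZeroOn
    rw [hw']
    exact hw0
  rw [← hw']
  rw [← hJ] at hwmin
  clear hw0 hw' hJ w
  have hE : dirEnergy G V = energyJ G w' := by
    refine IsLeast.csInf_eq ⟨⟨w', hw'0, rfl⟩, ?_⟩
    rintro _ ⟨u, hu, rfl⟩
    exact hwmin u hu
  intro j' hjj' i i' hii'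
  have hj : ∀ a, G.edge j a → a = j' := fun a ha =>
    MetricGraph.eq_of_degree_eq_one hjdeg ha hjj'
  have hj'j := G.edge_symm _ _ hjj'
  by_cases hij : i = j
  · subst hij
    obtain rfl := hj i' hii'
    intro x hx
    rw [w'.symm _ _ hj'j]
    rw [G.len_symm] at hx
    exact w'.le_of_pendant hw'0 hsymm hwmin hj'j hj hjV ⟨by linarith [hx.2], by linarith [hx.1]⟩
  by_cases hi'j : i' = j
  · subst hi'j
    obtain rfl := hj i (G.edge_symm _ _ hii')
    intro x hx
    exact w'.le_of_pendant hw'0 hsymm hwmin hj'j hj hjV hx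
  have hL := G.len_pos i i' hii'
  have hcl := closure_Ioo hL.ne
  have hcont := (w'.isH1On hii').continuousOn hL.le
  rw [← hcl] at hcont ⊢
  refine fun x hx => le_on_closure (fun s hs => ?_) hcont continuousOn_const hx
  by_contra! hlt
  obtain ⟨K, W, η, v, hK, hKl, hη, hv0, hv⟩ := exists_regraft_energyJ_lt hGc γ hw'0 hsymm hjV hii'
    hjj' hj hij hi'j hs hlt
  have hη' := hη.trans hγ
  have h1 := hmin K W η hK (hKl.trans hGl) hη'
  have h2 : dirEnergy K W ≤ energyJ K v :=
    csInf_le (hK.bddBelow_energyJ (hVne η hη')) ⟨v, hv0, rfl⟩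
  linarith
end
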